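/- arXiv:1707.00476 — 3 statements merged into one kernel-verified Lean document; each statement's English description precedes it below -/
import Mathlib

section
/- There exists a function α : ℕ → ℝ with α(d) · 2^d / (log(2/√3) · d) → 1 as d → ∞ such that for every ε > 0 there exists d₀ with the following property: for all dimensions d ≥ d₀, liminf_{n→∞} (1/(α(d)·n)) · log( Ẑ_{B_n}(⌊α(d)·n⌋) · ⌊α(d)·n⌋! / n^{⌊α(d)·n⌋} ) ≥ −(1 + ε) · log(2/√3) · d. (This is the lower bound f_d(α) ≥ −(1 + o_d(1)) log(2/√3) · d on the entropy density of sphere packings at density α = (1 + o_d(1)) log(2/√3) · d · 2^{-d}.) -/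
open MeasureTheory Filter

/-- `rd d` is the radius of a Euclidean ball of volume 1 in `ℝ^d`. -/
noncomputable def rd (d : ℕ) : ℝ :=
  ((volume (Metric.closedBall (0 : EuclideanSpace ℝ (Fin d)) 1)).toReal) ^ (-(1 : ℝ) / d)

/-- The set of `k`-tuples of points of `S` with pairwise distances `> 2 r_d`,
i.e. centers of packings by balls of volume 1. -/
def packSet (d k : ℕ) (S : Set (EuclideanSpace ℝ (Fin d))) :
    Set (Fin k → EuclideanSpace ℝ (Fin d)) :=
  {x | (∀ i, x i ∈ S) ∧ ∀ i j, i ≠ j → dist (x i) (x j) > 2 * rd d}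

/-- The canonical hard sphere partition function `Ẑ_S(k)`. -/
noncomputable def Zhat (d : ℕ) (S : Set (EuclideanSpace ℝ (Fin d))) (k : ℕ) : ℝ :=
  (1 / (Nat.factorial k : ℝ)) *
    ∫ x : Fin k → EuclideanSpace ℝ (Fin d),
      Set.indicator (packSet d k S) (fun _ => (1 : ℝ)) x

/-- The grand canonical hard sphere partition function `Z_S(λ)`. -/
noncomputable def Zgc (d : ℕ) (S : Set (EuclideanSpace ℝ (Fin d))) (lam : ℝ) : ℝ :=
  ∑' k : ℕ, lam ^ k * Zhat d S k

/-- The expected packing density `α_S(λ)` of the hard sphere model. -/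
noncomputable def alphaS (d : ℕ) (S : Set (EuclideanSpace ℝ (Fin d))) (lam : ℝ) : ℝ :=
  (∑' k : ℕ, (k : ℝ) * lam ^ k * Zhat d S k) / ((volume S).toReal * Zgc d S lam)

/-- `Bn d n` is the closed ball of volume `n` centered at the origin in `ℝ^d`. -/
noncomputable def Bn (d : ℕ) (n : ℝ) : Set (EuclideanSpace ℝ (Fin d)) :=
  Metric.closedBall 0 (n ^ ((1 : ℝ) / d) * rd d)

/-- The maximum number of centers of a packing of `B_n` by balls of volume 1. -/
noncomputable def Md (d : ℕ) (n : ℝ) : ℝ :=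
  sSup {m : ℝ | ∃ X : Finset (EuclideanSpace ℝ (Fin d)),
    (∀ x ∈ X, x ∈ Bn d n) ∧ (∀ x ∈ X, ∀ y ∈ X, x ≠ y → dist x y > 2 * rd d) ∧
    m = (X.card : ℝ)}

/-- The externally uncovered region `T(v,X)` for a configuration `X = (x_1,…,x_k)`. -/
def Treg (d : ℕ) (S : Set (EuclideanSpace ℝ (Fin d))) (v : EuclideanSpace ℝ (Fin d))
    {k : ℕ} (x : Fin k → EuclideanSpace ℝ (Fin d)) : Set (EuclideanSpace ℝ (Fin d)) :=
  {p | p ∈ Metric.closedBall v (2 * rd d) ∩ S ∧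
    ∀ i, dist (x i) v > 2 * rd d → dist p (x i) > 2 * rd d}

/-- The expectation of a functional `g(v, X)` under the two-part experiment:
`X` drawn from the hard sphere model on `S` at fugacity `λ`, and independently
`v` uniform in `S`. -/
noncomputable def ExpT (d : ℕ) (S : Set (EuclideanSpace ℝ (Fin d))) (lam : ℝ)
    (g : EuclideanSpace ℝ (Fin d) → ∀ k : ℕ, (Fin k → EuclideanSpace ℝ (Fin d)) → ℝ) : ℝ :=
  (1 / ((volume S).toReal * Zgc d S lam)) *
    ∑' k : ℕ, (lam ^ k / (Nat.factorial k : ℝ)) *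
      ∫ v in S, ∫ x : Fin k → EuclideanSpace ℝ (Fin d),
        Set.indicator (packSet d k S) (fun y => g v k y) x



section Abstract
open scoped ENNReal

/-- measurable subsets -/
abbrev HSet (E : Type) [MeasurableSpace E] := {S : Set E // MeasurableSet S}

/-- slice of a measurable family -/
def hslice {E P : Type} [MeasurableSpace E] [MeasurableSpace P] (W : HSet (P × E)) (p : P) :
    HSet E := ⟨Prod.mk p ⁻¹' W.1, measurable_prodMk_left W.2⟩

/-- functionals on measurable sets which are measurable along measurable families -/
def HG (E : Type) [MeasurableSpace E] : AddSubmonoid (HSet E → ℝ≥0∞) where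
  carrier := {g | ∀ (P : Type) (_ : MeasurableSpace P) (W : HSet (P × E)),
    Measurable (fun p => g (hslice W p))}
  add_mem' := fun {a b} ha hb P _ W => (ha P _ W).add (hb P _ W)
  zero_mem' := fun P _ W => measurable_const

/-- A measurable symmetric exclusion relation -/
structure HExcl (E : Type) [MeasurableSpace E] where
  R : Set (E × E)
  meas : MeasurableSet R
  symm : ∀ x y, (x, y) ∈ R → (y, x) ∈ R

variable {E : Type} [MeasurableSpace E]

/-- remove excluded region -/
def HExcl.rem (B : HExcl E) (S : HSet E) (x : E) : HSet E :=
  ⟨{y | y ∈ S.1 ∧ (x, y) ∉ B.R}, S.2.inter (measurable_prodMk_left B.meas).compl⟩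

/-- family of removals -/
def HExcl.fam (B : HExcl E) {P : Type} [MeasurableSpace P] (W : HSet (P × E)) :
    HSet ((P × E) × E) :=
  ⟨{q | (q.1.1, q.2) ∈ W.1 ∧ (q.1.2, q.2) ∉ B.R}, by
    have h1 : Measurable (fun q : (P × E) × E => (q.1.1, q.2)) := by fun_prop
    have h2 : Measurable (fun q : (P × E) × E => (q.1.2, q.2)) := by fun_prop
    exact (h1 W.2).inter (h2 B.meas).compl⟩

lemma HExcl.fam_slice (B : HExcl E) {P : Type} [MeasurableSpace P] (W : HSet (P × E))
    (q : P × E) : hslice (B.fam W) q = B.rem (hslice W q.1) q.2 := rfl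

/-- constant family -/
def hconst (S : HSet E) : HSet (Unit × E) := ⟨Prod.snd ⁻¹' S.1, measurable_snd S.2⟩

lemma HExcl.meas_rem (B : HExcl E) (S : HSet E) (g : HG E) :
    Measurable (fun x => g.1 (B.rem S x)) := by
  have := g.2 _ _ (B.fam (hconst S))
  exact this.comp (measurable_prodMk_left (x := ()))

variable (μ : Measure E) [SFinite μ] (B : HExcl E)

/-- raw integration operator -/
noncomputable def hI0 (A : HSet E) (g : HSet E → ℝ≥0∞) (S : HSet E) : ℝ≥0∞ :=
  ∫⁻ x in A.1 ∩ S.1, g (B.rem S x) ∂μ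

lemma hI0_good (A : HSet E) (g : HG E) : hI0 μ B A g.1 ∈ HG E := by
  intro P _ W
  have h := g.2 _ _ (B.fam W)
  have hm : MeasurableSet {q : P × E | q.2 ∈ A.1 ∧ q ∈ W.1} :=
    (measurable_snd A.2).inter W.2
  have h2 := (h.indicator hm).lintegral_prod_right' (ν := μ)
  convert h2 using 2 with p
  unfold hI0
  rw [← lintegral_indicator (A.2.inter (hslice W p).2)]
  rfl

/-- integration operator -/
noncomputable def hI (A : HSet E) : AddMonoid.End (HG E) where
  toFun g := ⟨hI0 μ B A g.1, hI0_good μ B A g⟩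
  map_zero' := by
    ext S
    simp [hI0]
  map_add' g h := by
    ext S
    simp only [hI0, AddSubmonoid.coe_add, Pi.add_apply]
    rw [lintegral_add_left (B.meas_rem S g)]

lemma hI_apply (A : HSet E) (g : HG E) (S : HSet E) :
    (hI μ B A g).1 S = ∫⁻ x in A.1 ∩ S.1, g.1 (B.rem S x) ∂μ := rfl

lemma B_rem_comm (S : HSet E) (x y : E) : B.rem (B.rem S x) y = B.rem (B.rem S y) x := by
  apply Subtype.ext
  ext z
  change ((z ∈ S.1 ∧ (x, z) ∉ B.R) ∧ (y, z) ∉ B.R) ↔ ((z ∈ S.1 ∧ (y, z) ∉ B.R) ∧ (x, z) ∉ B.R)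
  tauto

lemma hI_comm (A U : HSet E) : Commute (hI μ B A) (hI μ B U) := by
  ext g S
  have key : ∀ A U : HSet E, (hI μ B A (hI μ B U g)).1 S =
      ∫⁻ x, ∫⁻ y, {q : E × E | (q.1 ∈ A.1 ∧ q.1 ∈ S.1) ∧ (q.2 ∈ U.1 ∧ q.2 ∈ S.1) ∧
        (q.1, q.2) ∉ B.R}.indicator (fun q => g.1 (B.rem (B.rem S q.1) q.2)) (x, y) ∂μ ∂μ := by
    intro A U
    rw [hI_apply, ← lintegral_indicator (A.2.inter S.2)]
    refine lintegral_congr fun x => ?_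
    by_cases hx : x ∈ A.1 ∩ S.1
    · rw [Set.indicator_of_mem hx, hI_apply, ← lintegral_indicator (U.2.inter (B.rem S x).2)]
      refine lintegral_congr fun y => ?_
      have h1 : x ∈ A.1 := hx.1
      have h2 : x ∈ S.1 := hx.2
      have h3 : y ∈ U.1 ∩ (B.rem S x).1 ↔ (x, y) ∈ {q : E × E | (q.1 ∈ A.1 ∧ q.1 ∈ S.1) ∧
          (q.2 ∈ U.1 ∧ q.2 ∈ S.1) ∧ (q.1, q.2) ∉ B.R} := by
        change (y ∈ U.1 ∧ y ∈ S.1 ∧ (x, y) ∉ B.R) ↔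
          ((x ∈ A.1 ∧ x ∈ S.1) ∧ (y ∈ U.1 ∧ y ∈ S.1) ∧ (x, y) ∉ B.R)
        tauto
      simp only [Set.indicator]
      congr 1
      exact propext h3
    · rw [Set.indicator_of_notMem hx]
      symm
      rw [lintegral_eq_zero_iff']
      · refine Eventually.of_forall fun y => ?_
        apply Set.indicator_of_notMem
        rintro ⟨h, -⟩
        exact hx h
      · have : ∀ y, {q : E × E | (q.1 ∈ A.1 ∧ q.1 ∈ S.1) ∧ (q.2 ∈ U.1 ∧ q.2 ∈ S.1) ∧
          (q.1, q.2) ∉ B.R}.indicator (fun q => g.1 (B.rem (B.rem S q.1) q.2)) (x, y) = 0 := by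
          intro y
          apply Set.indicator_of_notMem
          rintro ⟨h, -⟩
          exact hx h
        simp only [this]
        exact aemeasurable_const
  change (hI μ B A (hI μ B U g)).1 S = (hI μ B U (hI μ B A g)).1 S
  rw [key A U, key U A, lintegral_lintegral_swap]
  · refine lintegral_congr fun y => lintegral_congr fun x => ?_
    have e : (x, y) ∉ B.R ↔ (y, x) ∉ B.R :=
      ⟨fun h h' => h (B.symm _ _ h'), fun h h' => h (B.symm _ _ h')⟩
    have h3 : (x, y) ∈ {q : E × E | (q.1 ∈ A.1 ∧ q.1 ∈ S.1) ∧
          (q.2 ∈ U.1 ∧ q.2 ∈ S.1) ∧ (q.1, q.2) ∉ B.R} ↔ (y, x) ∈ {q : E × E |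
          (q.1 ∈ U.1 ∧ q.1 ∈ S.1) ∧ (q.2 ∈ A.1 ∧ q.2 ∈ S.1) ∧ (q.1, q.2) ∉ B.R} := by
      change ((x ∈ A.1 ∧ x ∈ S.1) ∧ (y ∈ U.1 ∧ y ∈ S.1) ∧ (x, y) ∉ B.R) ↔
        ((y ∈ U.1 ∧ y ∈ S.1) ∧ (x ∈ A.1 ∧ x ∈ S.1) ∧ (y, x) ∉ B.R)
      tauto
    simp only [Set.indicator, B_rem_comm B S x y]
    congr 1
    exact propext h3
  · apply Measurable.aemeasurable
    have h := g.2 _ _ (B.fam (B.fam (hconst S)))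
    have h' : Measurable (fun q : E × E => (((), q.1), q.2)) := by fun_prop
    have h2 := h.comp h'
    refine Measurable.indicator h2 ?_
    exact ((measurable_fst A.2).inter (measurable_fst S.2)).inter
      (((measurable_snd U.2).inter (measurable_snd S.2)).inter B.meas.compl)

/-- complement -/
def hcompl (A : HSet E) : HSet E := ⟨A.1ᶜ, A.2.compl⟩
/-- whole space -/
def huniv : HSet E := ⟨Set.univ, MeasurableSet.univ⟩
/-- intersection -/
def hinter (S A : HSet E) : HSet E := ⟨S.1 ∩ A.1, S.2.inter A.2⟩

lemma hI_add (A : HSet E) : hI μ B (hcompl A) + hI μ B A = hI μ B huniv := by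
  ext g S
  change (hI μ B (hcompl A) g).1 S + (hI μ B A g).1 S = (hI μ B huniv g).1 S
  simp only [hI_apply, hcompl, huniv, Set.univ_inter]
  rw [add_comm, Set.inter_comm, Set.inter_comm A.1ᶜ, ← Set.sdiff_eq, lintegral_inter_add_sdiff _ _ A.2]

lemma hI_mono (A : HSet E) (g h : HG E) (hgh : ∀ S, g.1 S ≤ h.1 S) (S : HSet E) :
    (hI μ B A g).1 S ≤ (hI μ B A h).1 S := by
  simp only [hI_apply]
  exact lintegral_mono fun x => hgh _

/-- one -/
def hone : HG E := ⟨fun _ => 1, fun _ _ _ => measurable_const⟩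

/-- weighted series -/
noncomputable def hser (c : ℕ → ℝ≥0∞) (g : ℕ → HG E) : HG E :=
  ⟨fun S => ∑' k, c k * (g k).1 S, fun P _ W =>
    Measurable.tsum fun k => ((g k).2 P _ W).const_mul _⟩

lemma hser_apply (c : ℕ → ℝ≥0∞) (g : ℕ → HG E) (S : HSet E) :
    (hser c g).1 S = ∑' k, c k * (g k).1 S := rfl

lemma hI_ser (A : HSet E) (c : ℕ → ℝ≥0∞) (g : ℕ → HG E) :
    hI μ B A (hser c g) = hser c (fun k => hI μ B A (g k)) := by
  apply Subtype.ext
  funext S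
  simp only [hI_apply, hser_apply]
  rw [lintegral_tsum]
  · refine tsum_congr fun k => ?_
    rw [lintegral_const_mul _ (B.meas_rem S (g k))]
  · intro k
    exact ((B.meas_rem S (g k)).const_mul _).aemeasurable

lemma hI_pow_ser (A : HSet E) (c : ℕ → ℝ≥0∞) (g : ℕ → HG E) (i : ℕ) :
    ((hI μ B A) ^ i) (hser c g) = hser c (fun k => ((hI μ B A) ^ i) (g k)) := by
  induction i with
  | zero => rfl
  | succ i ih =>
    rw [pow_succ']
    change hI μ B A (((hI μ B A) ^ i) (hser c g)) = _
    rw [ih, hI_ser]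
    rfl

lemma hI_pow_mono (A : HSet E) (i : ℕ) (g h : HG E) (hgh : ∀ S, g.1 S ≤ h.1 S) (S : HSet E) :
    (((hI μ B A) ^ i) g).1 S ≤ (((hI μ B A) ^ i) h).1 S := by
  induction i generalizing S with
  | zero => exact hgh S
  | succ i ih =>
    rw [pow_succ']
    exact hI_mono μ B A _ _ ih S

/-- exponential weights -/
noncomputable def hc (l : ℝ) (k : ℕ) : ℝ≥0∞ := ENNReal.ofReal (l ^ k / k.factorial)

/-- exponential of operator -/
noncomputable def hE (l : ℝ) (A : HSet E) (g : HG E) : HG E :=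
  hser (hc l) (fun k => ((hI μ B A) ^ k) g)

lemma hc_mul (l : ℝ) (hl : 0 ≤ l) (i j : ℕ) :
    hc l (i + j) * ((i + j).choose i : ℕ) = hc l i * hc l j := by
  unfold hc
  rw [← ENNReal.ofReal_mul (by positivity), ← ENNReal.ofReal_natCast,
    ← ENNReal.ofReal_mul (by positivity)]
  congr 1
  rw [Nat.cast_add_choose]
  have := Nat.factorial_ne_zero (i+j)
  have : ((i+j).factorial : ℝ) ≠ 0 := by exact_mod_cast this
  field_simp
  ring

lemma hG_sum_apply {ι : Type} (s : Finset ι) (g : ι → HG E) (S : HSet E) :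
    (∑ i ∈ s, g i).1 S = ∑ i ∈ s, (g i).1 S := by
  rw [AddSubmonoid.coe_finsetSum, Finset.sum_apply]

lemma hG_nsmul_apply (n : ℕ) (g : HG E) (S : HSet E) :
    (n • g).1 S = n * g.1 S := by
  change (n • g.1 S) = _
  rw [nsmul_eq_mul]

lemma End_sum_apply {ι : Type} (s : Finset ι) (f : ι → AddMonoid.End (HG E)) (g : HG E) :
    (∑ i ∈ s, f i) g = ∑ i ∈ s, f i g := by
  exact AddMonoidHom.finsetSum_apply f s g

lemma hE_split (l : ℝ) (hl : 0 ≤ l) (A : HSet E) (g : HG E) :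
    hE μ B l huniv g = hE μ B l (hcompl A) (hE μ B l A g) := by
  apply Subtype.ext
  funext S
  have h1 : (hE μ B l (hcompl A) (hE μ B l A g)).1 S =
      ∑' (p : ℕ × ℕ), hc l p.1 * hc l p.2 *
        (((hI μ B (hcompl A)) ^ p.1) (((hI μ B A) ^ p.2) g)).1 S := by
    rw [ENNReal.tsum_prod']
    unfold hE
    rw [hser_apply]
    refine tsum_congr fun i => ?_
    rw [hI_pow_ser, hser_apply, ← ENNReal.tsum_mul_left]
    refine tsum_congr fun j => ?_
    simp only [mul_assoc]
  rw [h1, ← Finset.HasAntidiagonal.sigmaAntidiagonalEquivProd.tsum_eq, ENNReal.tsum_sigma']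
  unfold hE
  rw [hser_apply]
  refine tsum_congr fun k => ?_
  rw [← hI_add μ B A, (hI_comm μ B (hcompl A) A).add_pow', End_sum_apply, hG_sum_apply,
    tsum_fintype, Finset.mul_sum, Finset.univ_eq_attach,
    ← Finset.sum_attach]
  refine Finset.sum_congr rfl fun p _ => ?_
  obtain ⟨⟨i, j⟩, hp⟩ := p
  have hk : i + j = k := by simpa using hp
  subst hk
  simp only [Finset.HasAntidiagonal.sigmaAntidiagonalEquivProd_apply]
  rw [← hc_mul l hl, mul_assoc, ← hG_nsmul_apply]
  rfl

lemma hI_pow_succ_apply (A : HSet E) (i : ℕ) (g : HG E) (S : HSet E) :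
    (((hI μ B A) ^ (i + 1)) g).1 S =
      ∫⁻ x in A.1 ∩ S.1, (((hI μ B A) ^ i) g).1 (B.rem S x) ∂μ := by
  rw [pow_succ']
  rfl

lemma rem_sub (S : HSet E) (x : E) : (B.rem S x).1 ⊆ S.1 := fun _ h => h.1

lemma rem_mono {S T : HSet E} (h : S.1 ⊆ T.1) (x : E) : (B.rem S x).1 ⊆ (B.rem T x).1 :=
  fun _ hy => ⟨h hy.1, hy.2⟩

lemma hI_pow_one_mono (A : HSet E) (i : ℕ) {S T : HSet E} (h : S.1 ⊆ T.1) :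
    (((hI μ B A) ^ i) hone).1 S ≤ (((hI μ B A) ^ i) hone).1 T := by
  induction i generalizing S T with
  | zero => exact le_refl (1 : ℝ≥0∞)
  | succ i ih =>
    rw [hI_pow_succ_apply, hI_pow_succ_apply]
    refine (lintegral_mono fun x => ih (rem_mono B h x)).trans ?_
    exact lintegral_mono_set (Set.inter_subset_inter_right _ h)

/-- the grand canonical partition function -/
noncomputable def hZ (l : ℝ) : HG E := hE μ B l huniv hone

/-- the k-point configuration integral -/
noncomputable def hM (k : ℕ) : HG E := ((hI μ B huniv) ^ k) hone

lemma hZ_apply (l : ℝ) (S : HSet E) : (hZ μ B l).1 S = ∑' k, hc l k * (hM μ B k).1 S := rfl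

lemma hM_zero (S : HSet E) : (hM μ B 0).1 S = 1 := rfl

lemma hM_succ (k : ℕ) (S : HSet E) :
    (hM μ B (k + 1)).1 S = ∫⁻ x in S.1, (hM μ B k).1 (B.rem S x) ∂μ := by
  unfold hM
  rw [hI_pow_succ_apply]
  simp [huniv]

lemma hM_mono (k : ℕ) {S T : HSet E} (h : S.1 ⊆ T.1) : (hM μ B k).1 S ≤ (hM μ B k).1 T :=
  hI_pow_one_mono μ B huniv k h

lemma hZ_mono (l : ℝ) {S T : HSet E} (h : S.1 ⊆ T.1) : (hZ μ B l).1 S ≤ (hZ μ B l).1 T := by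
  simp only [hZ_apply]
  exact ENNReal.tsum_le_tsum fun k => mul_le_mul_right (hM_mono μ B k h) _

lemma hM_le (k : ℕ) (S : HSet E) : (hM μ B k).1 S ≤ μ S.1 ^ k := by
  induction k generalizing S with
  | zero => simp [hM_zero]
  | succ k ih =>
    rw [hM_succ]
    calc _ ≤ ∫⁻ x in S.1, μ S.1 ^ k ∂μ := lintegral_mono fun x =>
            (ih _).trans (pow_le_pow_left' (measure_mono (rem_sub B S x)) k)
      _ = _ := by rw [setLIntegral_const, pow_succ]

lemma hI_pow_inter (A : HSet E) (k : ℕ) (S : HSet E) :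
    (((hI μ B A) ^ k) hone).1 S = (hM μ B k).1 (hinter S A) := by
  induction k generalizing S with
  | zero => rfl
  | succ k ih =>
    rw [hI_pow_succ_apply, hM_succ]
    simp only [ih]
    have : ∀ x, hinter (B.rem S x) A = B.rem (hinter S A) x := by
      intro x
      apply Subtype.ext
      ext z
      change ((z ∈ S.1 ∧ (x, z) ∉ B.R) ∧ z ∈ A.1) ↔ ((z ∈ S.1 ∧ z ∈ A.1) ∧ (x, z) ∉ B.R)
      tauto
    simp only [this]
    rw [Set.inter_comm]
    rfl

lemma hE_one (l : ℝ) (A S : HSet E) : (hE μ B l A hone).1 S = (hZ μ B l).1 (hinter S A) := by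
  rw [hZ_apply]
  unfold hE
  rw [hser_apply]
  simp only [hI_pow_inter]

lemma hI_pow_le_const (U : HSet E) (i : ℕ) (g : HG E) (a : ℝ≥0∞) (S : HSet E)
    (h : ∀ T : HSet E, T.1 ⊆ S.1 → g.1 T ≤ a) :
    (((hI μ B U) ^ i) g).1 S ≤ a * (((hI μ B U) ^ i) hone).1 S := by
  induction i generalizing S with
  | zero =>
    change g.1 S ≤ a * 1
    rw [mul_one]
    exact h S subset_rfl
  | succ i ih =>
    rw [hI_pow_succ_apply, hI_pow_succ_apply, ← lintegral_const_mul _ (B.meas_rem S _)]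
    exact lintegral_mono fun x => ih _ fun T hT => h T (hT.trans (rem_sub B S x))

lemma hZ_submul (l : ℝ) (hl : 0 ≤ l) (A S : HSet E) :
    (hZ μ B l).1 S ≤ (hZ μ B l).1 (hinter S A) * (hZ μ B l).1 (hinter S (hcompl A)) := by
  rw [← hE_one μ B l (hcompl A) S]
  conv_lhs => rw [hZ, hE_split μ B l hl A]
  unfold hE
  rw [hser_apply, hser_apply, ← ENNReal.tsum_mul_left]
  refine ENNReal.tsum_le_tsum fun i => ?_
  rw [mul_left_comm]
  refine mul_le_mul_right (hI_pow_le_const μ B _ i _ _ _ fun T hT => ?_) _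
  change (hE μ B l A hone).1 T ≤ _
  rw [hE_one]
  exact hZ_mono μ B l (Set.inter_subset_inter_left _ hT)

lemma hI_pow_lin (U : HSet E) (i : ℕ) (g h k : HG E) (a b c : ℝ≥0∞)
    (H : ∀ S, a * g.1 S ≤ b * h.1 S + c * k.1 S) (S : HSet E) :
    a * (((hI μ B U) ^ i) g).1 S ≤
      b * (((hI μ B U) ^ i) h).1 S + c * (((hI μ B U) ^ i) k).1 S := by
  induction i generalizing S with
  | zero => exact H S
  | succ i ih =>
    rw [hI_pow_succ_apply, hI_pow_succ_apply, hI_pow_succ_apply,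
      ← lintegral_const_mul _ (B.meas_rem S _), ← lintegral_const_mul _ (B.meas_rem S _),
      ← lintegral_const_mul _ (B.meas_rem S _),
      ← lintegral_add_left ((B.meas_rem S _).const_mul _)]
    exact lintegral_mono fun x => ih _

/-- local to global -/
lemma hZ_global (l : ℝ) (hl : 0 ≤ l) (A : HSet E) (a b c : ℝ≥0∞)
    (H : ∀ T : HSet E, T.1 ⊆ A.1 → a * (hZ μ B l).1 T ≤ b +
      c * ∫⁻ x in T.1, (hZ μ B l).1 (B.rem T x) ∂μ) (S : HSet E) :
    a * (hZ μ B l).1 S ≤ b * (hZ μ B l).1 (hinter S (hcompl A)) +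
      c * ∫⁻ x in A.1 ∩ S.1, (hZ μ B l).1 (B.rem S x) ∂μ := by
  have H' : ∀ S, a * (hE μ B l A hone).1 S ≤ b * hone.1 S +
      c * (hI μ B A (hE μ B l A hone)).1 S := by
    intro S
    have h1 := H (hinter S A) Set.inter_subset_right
    rw [hI_apply]
    simp only [hE_one]
    have : ∀ x, hinter (B.rem S x) A = B.rem (hinter S A) x := by
      intro x
      apply Subtype.ext
      ext z
      change ((z ∈ S.1 ∧ (x, z) ∉ B.R) ∧ z ∈ A.1) ↔ ((z ∈ S.1 ∧ z ∈ A.1) ∧ (x, z) ∉ B.R)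
      tauto
    simp only [this]
    rw [Set.inter_comm A.1]
    refine h1.trans (le_of_eq ?_)
    change _ = b * 1 + _
    rw [mul_one]
    rfl
  have h2 : ∀ i, a * (hc l i * (((hI μ B (hcompl A)) ^ i) (hE μ B l A hone)).1 S) ≤
      b * (hc l i * (((hI μ B (hcompl A)) ^ i) hone).1 S) +
      c * (hc l i * (((hI μ B (hcompl A)) ^ i) (hI μ B A (hE μ B l A hone))).1 S) := by
    intro i
    have := hI_pow_lin μ B (hcompl A) i _ _ _ a b c H' S
    calc _ = hc l i * (a * (((hI μ B (hcompl A)) ^ i) (hE μ B l A hone)).1 S) := by ring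
      _ ≤ hc l i * _ := mul_le_mul_right this _
      _ = _ := by ring
  have h3 := ENNReal.tsum_le_tsum h2
  rw [ENNReal.tsum_add, ENNReal.tsum_mul_left, ENNReal.tsum_mul_left, ENNReal.tsum_mul_left] at h3
  have h4 : (hZ μ B l).1 S =
      ∑' i, hc l i * (((hI μ B (hcompl A)) ^ i) (hE μ B l A hone)).1 S := by
    rw [hZ, hE_split μ B l hl A]
    rfl
  have h5 : (hZ μ B l).1 (hinter S (hcompl A)) =
      ∑' i, hc l i * (((hI μ B (hcompl A)) ^ i) hone).1 S := by
    rw [← hE_one]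
    rfl
  have h6 : ∫⁻ x in A.1 ∩ S.1, (hZ μ B l).1 (B.rem S x) ∂μ =
      ∑' i, hc l i * (((hI μ B (hcompl A)) ^ i) (hI μ B A (hE μ B l A hone))).1 S := by
    rw [← hI_apply, hZ, hE_split μ B l hl A]
    conv_lhs => rw [hE, hI_ser]
    rw [hser_apply]
    refine tsum_congr fun i => ?_
    have := (hI_comm μ B A (hcompl A)).pow_right i
    have h7 : hI μ B A ((hI μ B (hcompl A) ^ i) (hE μ B l A hone)) =
      (hI μ B (hcompl A) ^ i) (hI μ B A (hE μ B l A hone)) :=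
      DFunLike.congr_fun this.eq (hE μ B l A hone)
    rw [h7]
  rw [h4, h5, h6]
  exact h3

lemma hM_shearer (k : ℕ) (S : HSet E) :
    (hM μ B (k + 1)).1 S ^ ((k : ℝ) / (k + 1)) ≤ (hM μ B k).1 S := by
  induction k generalizing S with
  | zero => simp [hM_zero]
  | succ k ih =>
    have h1 : (hM μ B (k + 1 + 1)).1 S ≤ (hM μ B (k + 1)).1 S ^ (((k : ℝ) + 2) / (k + 1)) := by
      rw [hM_succ]
      calc _ ≤ ∫⁻ x in S.1, (hM μ B (k + 1)).1 S ^ (1 / ((k : ℝ) + 1)) *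
              (hM μ B k).1 (B.rem S x) ∂μ := by
            refine lintegral_mono fun x => ?_
            calc (hM μ B (k + 1)).1 (B.rem S x) =
                (hM μ B (k + 1)).1 (B.rem S x) ^ (1 / ((k : ℝ) + 1)) *
                (hM μ B (k + 1)).1 (B.rem S x) ^ ((k : ℝ) / (k + 1)) := by
                  rw [← ENNReal.rpow_add_of_nonneg _ _ (by positivity) (by positivity)]
                  rw [← add_div, add_comm (1 : ℝ), div_self (by positivity), ENNReal.rpow_one]
              _ ≤ _ := by
                  refine mul_le_mul' ?_ (ih _)
                  exact ENNReal.rpow_le_rpow (hM_mono μ B _ (rem_sub B S x)) (by positivity)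
        _ = (hM μ B (k + 1)).1 S ^ (1 / ((k : ℝ) + 1)) * (hM μ B (k + 1)).1 S := by
            rw [lintegral_const_mul _ (B.meas_rem S _), ← hM_succ]
        _ = (hM μ B (k + 1)).1 S ^ (1 / ((k : ℝ) + 1)) * (hM μ B (k + 1)).1 S ^ (1 : ℝ) := by
            rw [ENNReal.rpow_one]
        _ = _ := by
            rw [← ENNReal.rpow_add_of_nonneg _ _ (by positivity) (by positivity)]
            congr 1
            field_simp
            ring
    calc _ ≤ ((hM μ B (k + 1)).1 S ^ (((k : ℝ) + 2) / (k + 1))) ^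
          (((k + 1 : ℕ) : ℝ) / ((k + 1 : ℕ) + 1)) := ENNReal.rpow_le_rpow h1 (by positivity)
      _ = (hM μ B (k + 1)).1 S ^ (1 : ℝ) := by
          rw [← ENNReal.rpow_mul]
          congr 1
          push_cast
          field_simp
          ring
      _ = _ := ENNReal.rpow_one _

lemma hM_root_anti (k K : ℕ) (hk : 1 ≤ k) (hK : k ≤ K) (S : HSet E) :
    (hM μ B K).1 S ^ (1 / (K : ℝ)) ≤ (hM μ B k).1 S ^ (1 / (k : ℝ)) := by
  induction K, hK using Nat.le_induction with
  | base => exact le_rfl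
  | succ m hm ih =>
    refine le_trans ?_ ih
    have hm0 : (0 : ℝ) < m := by exact_mod_cast (by omega : 0 < m)
    have := ENNReal.rpow_le_rpow (hM_shearer μ B m S) (z := 1 / (m : ℝ)) (by positivity)
    rw [← ENNReal.rpow_mul] at this
    refine le_trans (le_of_eq ?_) this
    congr 1
    push_cast
    field_simp

lemma hM_pow_le (k K : ℕ) (hk : 1 ≤ k) (hK : k ≤ K) (S : HSet E) (q : ℝ≥0∞)
    (h : q ^ K ≤ (hM μ B K).1 S) : q ^ k ≤ (hM μ B k).1 S := by
  have hk0 : (k : ℝ) ≠ 0 := by exact_mod_cast (by omega : k ≠ 0)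
  have hK0 : (K : ℝ) ≠ 0 := by exact_mod_cast (by omega : K ≠ 0)
  have h1 : q ≤ (hM μ B K).1 S ^ (1 / (K : ℝ)) := by
    have := ENNReal.rpow_le_rpow h (z := 1 / (K : ℝ)) (by positivity)
    rw [← ENNReal.rpow_natCast, ← ENNReal.rpow_mul, mul_one_div_cancel hK0, ENNReal.rpow_one]
      at this
    exact this
  have h2 := h1.trans (hM_root_anti μ B k K hk hK S)
  have h3 := ENNReal.rpow_le_rpow h2 (z := (k : ℝ)) (by positivity)
  rw [← ENNReal.rpow_mul, one_div_mul_cancel hk0, ENNReal.rpow_one, ENNReal.rpow_natCast] at h3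
  exact h3

lemma hZ_le_exp (l : ℝ) (hl : 0 ≤ l) (S : HSet E) (hS : μ S.1 ≠ ∞) :
    (hZ μ B l).1 S ≤ ENNReal.ofReal (Real.exp (l * (μ S.1).toReal)) := by
  rw [hZ_apply]
  set V := (μ S.1).toReal with hV
  have hV0 : 0 ≤ V := ENNReal.toReal_nonneg
  have h1 : HasSum (fun k : ℕ => (l * V) ^ k / (k.factorial : ℝ)) (Real.exp (l * V)) := by
    rw [Real.exp_eq_exp_ℝ]
    exact NormedSpace.expSeries_div_hasSum_exp (l * V)
  rw [← h1.tsum_eq, ENNReal.ofReal_tsum_of_nonneg (fun k => by positivity) h1.summable]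
  refine ENNReal.tsum_le_tsum fun k => ?_
  calc _ ≤ hc l k * μ S.1 ^ k := mul_le_mul_right (hM_le μ B k S) _
    _ = hc l k * ENNReal.ofReal V ^ k := by rw [hV, ENNReal.ofReal_toReal hS]
    _ = _ := by
      unfold hc
      rw [← ENNReal.ofReal_pow hV0, ← ENNReal.ofReal_mul (by positivity)]
      congr 1
      rw [mul_pow]
      ring

lemma hZ_ne_top (l : ℝ) (hl : 0 ≤ l) (S : HSet E) (hS : μ S.1 ≠ ∞) : (hZ μ B l).1 S ≠ ∞ :=
  ne_top_of_le_ne_top ENNReal.ofReal_ne_top (hZ_le_exp μ B l hl S hS)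

lemma one_le_hZ (l : ℝ) (S : HSet E) : 1 ≤ (hZ μ B l).1 S := by
  rw [hZ_apply]
  refine le_trans ?_ (ENNReal.le_tsum 0)
  simp [hc, hM_zero]

/-- excluded region of a point -/
def HExcl.nb (B : HExcl E) (x : E) : HSet E :=
  ⟨{y | (x, y) ∈ B.R}, measurable_prodMk_left B.meas⟩

lemma rem_eq (S : HSet E) (x : E) : B.rem S x = hinter S (hcompl (B.nb x)) := rfl

lemma hF_ne_top (l : ℝ) (hl : 0 ≤ l) (S : HSet E) (hS : μ S.1 ≠ ∞) :
    ∫⁻ x in S.1, (hZ μ B l).1 (B.rem S x) ∂μ ≠ ∞ := by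
  have : ∫⁻ x in S.1, (hZ μ B l).1 (B.rem S x) ∂μ ≤ ∫⁻ _ in S.1, (hZ μ B l).1 S ∂μ :=
    lintegral_mono fun x => hZ_mono μ B l (rem_sub B S x)
  refine ne_top_of_le_ne_top ?_ this
  rw [setLIntegral_const]
  exact ENNReal.mul_ne_top (hZ_ne_top μ B l hl S hS) hS

lemma meas_nb_inter (T : HSet E) : Measurable (fun x => μ (T.1 ∩ (B.nb x).1)) := by
  have hm : MeasurableSet {q : E × E | q.2 ∈ T.1 ∧ q ∈ B.R} := (measurable_snd T.2).inter B.meas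
  exact measurable_measure_prodMk_left hm

lemma hZ_local (l : ℝ) (hl : 0 ≤ l) (D : ℝ) (hD : 0 ≤ D) (T : HSet E) (hT : μ T.1 ≠ ∞)
    (hgeo : ∫⁻ x in T.1, μ (T.1 ∩ (B.nb x).1) ∂μ ≤ ENNReal.ofReal D * μ T.1)
    (t : ℝ) (ht : 0 ≤ t) :
    ENNReal.ofReal (1 + t) * (hZ μ B l).1 T ≤ ENNReal.ofReal (Real.exp t) +
      ENNReal.ofReal (l * Real.exp (l * D)) *
        ∫⁻ x in T.1, (hZ μ B l).1 (B.rem T x) ∂μ := by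
  set F := ∫⁻ x in T.1, (hZ μ B l).1 (B.rem T x) ∂μ with hF
  have hFt : F ≠ ∞ := hF_ne_top μ B l hl T hT
  have hZt := hZ_ne_top μ B l hl T hT
  have hZ1 := one_le_hZ μ B l T
  set Z := (hZ μ B l).1 T with hZdef
  have hpt : ∀ x, ENNReal.ofReal (l * (1 + l * D)) * Z ≤
      ENNReal.ofReal (l * Real.exp (l * D)) * (hZ μ B l).1 (B.rem T x) +
        ENNReal.ofReal (l ^ 2) * Z * μ (T.1 ∩ (B.nb x).1) := by
    intro x
    have hm : μ (T.1 ∩ (B.nb x).1) ≠ ∞ :=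
      ne_top_of_le_ne_top hT (measure_mono Set.inter_subset_left)
    set m := (μ (T.1 ∩ (B.nb x).1)).toReal with hmdef
    have hm0 : 0 ≤ m := ENNReal.toReal_nonneg
    have h1 : Z ≤ ENNReal.ofReal (Real.exp (l * m)) * (hZ μ B l).1 (B.rem T x) := by
      refine (hZ_submul μ B l hl (B.nb x) T).trans ?_
      rw [rem_eq]
      refine mul_le_mul_left ?_ _
      exact hZ_le_exp μ B l hl (hinter T (B.nb x)) hm
    have hrt : (hZ μ B l).1 (B.rem T x) ≠ ∞ := hZ_ne_top μ B l hl _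
      (ne_top_of_le_ne_top hT (measure_mono (rem_sub B T x)))
    set R := (hZ μ B l).1 (B.rem T x) with hR
    have h2 : Z.toReal ≤ Real.exp (l * m) * R.toReal := by
      have := ENNReal.toReal_mono (ENNReal.mul_ne_top ENNReal.ofReal_ne_top hrt) h1
      rwa [ENNReal.toReal_mul, ENNReal.toReal_ofReal (Real.exp_pos _).le] at this
    have hZ0 : 0 ≤ Z.toReal := ENNReal.toReal_nonneg
    have hR0 : 0 ≤ R.toReal := ENNReal.toReal_nonneg
    have h3 : (1 + l * D - l * m) * Z.toReal ≤ Real.exp (l * D) * R.toReal := by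
      have h4 : 1 + (l * D - l * m) ≤ Real.exp (l * D - l * m) := by
        have := Real.add_one_le_exp (l * D - l * m); linarith
      calc _ ≤ Real.exp (l * D - l * m) * Z.toReal := by
            apply mul_le_mul_of_nonneg_right _ hZ0; linarith
        _ ≤ Real.exp (l * D - l * m) * (Real.exp (l * m) * R.toReal) :=
            mul_le_mul_of_nonneg_left h2 (Real.exp_pos _).le
        _ = _ := by rw [← mul_assoc, ← Real.exp_add]; congr 2; ring
    rw [← ENNReal.ofReal_toReal hZt, ← ENNReal.ofReal_toReal hrt, ← ENNReal.ofReal_toReal hm,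
      ← hmdef, ← ENNReal.ofReal_mul (by positivity), ← ENNReal.ofReal_mul (by positivity),
      ← ENNReal.ofReal_mul (by positivity), ← ENNReal.ofReal_mul (by positivity),
      ← ENNReal.ofReal_add (by positivity) (by positivity)]
    apply ENNReal.ofReal_le_ofReal
    have := mul_le_mul_of_nonneg_left h3 hl
    nlinarith
  have hint : ENNReal.ofReal (l * (1 + l * D)) * Z * μ T.1 ≤
      ENNReal.ofReal (l * Real.exp (l * D)) * F +
        ENNReal.ofReal (l ^ 2) * Z * (ENNReal.ofReal D * μ T.1) := by
    calc _ = ∫⁻ x in T.1, ENNReal.ofReal (l * (1 + l * D)) * Z ∂μ := by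
            rw [setLIntegral_const]
      _ ≤ _ := lintegral_mono hpt
      _ = _ := by
          rw [lintegral_add_left ((B.meas_rem T _).const_mul _),
            lintegral_const_mul _ (B.meas_rem T _), lintegral_const_mul _ (meas_nb_inter μ B T)]
      _ ≤ _ := by gcongr
  set V := (μ T.1).toReal with hV
  have hV0 : 0 ≤ V := ENNReal.toReal_nonneg
  have hzV : Z.toReal ≤ Real.exp (l * V) := by
    have := ENNReal.toReal_mono ENNReal.ofReal_ne_top (hZ_le_exp μ B l hl T hT)
    rwa [ENNReal.toReal_ofReal (Real.exp_pos _).le] at this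
  have hz1 : 1 ≤ Z.toReal := by
    have := ENNReal.toReal_mono hZt hZ1
    simpa using this
  have hf0 : 0 ≤ F.toReal := ENNReal.toReal_nonneg
  rw [← ENNReal.ofReal_toReal hZt, ← ENNReal.ofReal_toReal hFt, ← ENNReal.ofReal_toReal hT,
      ← hV, ← ENNReal.ofReal_mul (by positivity), ← ENNReal.ofReal_mul (by positivity),
      ← ENNReal.ofReal_mul (by positivity), ← ENNReal.ofReal_mul (by positivity),
      ← ENNReal.ofReal_mul (by positivity), ← ENNReal.ofReal_mul (by positivity),
      ← ENNReal.ofReal_add (by positivity) (by positivity),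
      ENNReal.ofReal_le_ofReal_iff (by positivity)] at hint
  rw [← ENNReal.ofReal_toReal hZt, ← ENNReal.ofReal_toReal hFt,
    ← ENNReal.ofReal_mul (by positivity),
      ← ENNReal.ofReal_mul (by positivity),
      ← ENNReal.ofReal_add (by positivity) (by positivity)]
  apply ENNReal.ofReal_le_ofReal
  set z := Z.toReal
  have hlog : Real.log z ≤ l * V := by
    rw [Real.log_le_iff_le_exp (by linarith)]
    exact hzV
  have h5 : z * (1 + t - Real.log z) ≤ Real.exp t := by
    have := Real.add_one_le_exp (t - Real.log z)
    calc _ ≤ z * Real.exp (t - Real.log z) := by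
          apply mul_le_mul_of_nonneg_left _ (by linarith); linarith
      _ = Real.exp t := by
          rw [Real.exp_sub, Real.exp_log (by linarith)]
          field_simp
  have h6 : z * Real.log z ≤ z * (l * V) := mul_le_mul_of_nonneg_left hlog (by linarith)
  nlinarith

lemma hZ_main (l : ℝ) (hl : 0 ≤ l) (D : ℝ) (hD : 0 ≤ D) (W : ℝ≥0∞) (hW : W ≠ ∞)
    (hnb : ∀ x, μ (B.nb x).1 ≤ W)
    (hgeo : ∀ v, ∀ T : HSet E, T.1 ⊆ (B.nb v).1 →
      ∫⁻ x in T.1, μ (T.1 ∩ (B.nb x).1) ∂μ ≤ ENNReal.ofReal D * μ T.1)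
    (t : ℝ) (ht : 0 ≤ t) (S : HSet E) :
    ENNReal.ofReal (1 + t) * (hZ μ B l).1 S * μ S.1 ≤
      (ENNReal.ofReal (Real.exp t) + ENNReal.ofReal (l * Real.exp (l * D)) * W) *
        ∫⁻ x in S.1, (hZ μ B l).1 (B.rem S x) ∂μ := by
  have h1 : ∀ v, ENNReal.ofReal (1 + t) * (hZ μ B l).1 S ≤
      ENNReal.ofReal (Real.exp t) * (hZ μ B l).1 (B.rem S v) +
      ENNReal.ofReal (l * Real.exp (l * D)) *
        ∫⁻ x in (B.nb v).1 ∩ S.1, (hZ μ B l).1 (B.rem S x) ∂μ := by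
    intro v
    exact hZ_global μ B l hl (B.nb v) _ _ _ (fun T hT => hZ_local μ B l hl D hD T
      (ne_top_of_le_ne_top hW ((measure_mono hT).trans (hnb v))) (hgeo v T hT) t ht) S
  have hmeas : Measurable (fun q : E × E => {q : E × E | q.2 ∈ S.1 ∧ q ∈ B.R}.indicator
      (fun q => (hZ μ B l).1 (B.rem S q.2)) q) :=
    Measurable.indicator ((B.meas_rem S (hZ μ B l)).comp measurable_snd)
      ((measurable_snd S.2).inter B.meas)
  have heq : ∀ v, ∫⁻ x in (B.nb v).1 ∩ S.1, (hZ μ B l).1 (B.rem S x) ∂μ =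
      ∫⁻ x, {q : E × E | q.2 ∈ S.1 ∧ q ∈ B.R}.indicator
      (fun q => (hZ μ B l).1 (B.rem S q.2)) (v, x) ∂μ := by
    intro v
    rw [Set.inter_comm, ← lintegral_indicator (S.2.inter (B.nb v).2)]
    rfl
  have h2 : ∫⁻ v in S.1, ∫⁻ x in (B.nb v).1 ∩ S.1, (hZ μ B l).1 (B.rem S x) ∂μ ∂μ ≤
      W * ∫⁻ x in S.1, (hZ μ B l).1 (B.rem S x) ∂μ := by
    simp only [heq]
    rw [lintegral_lintegral_swap hmeas.aemeasurable,
      ← lintegral_const_mul _ (B.meas_rem S _), ← lintegral_indicator S.2]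
    refine lintegral_mono fun x => ?_
    by_cases hx : x ∈ S.1
    · rw [Set.indicator_of_mem hx]
      have : ∀ v, {q : E × E | q.2 ∈ S.1 ∧ q ∈ B.R}.indicator
          (fun q => (hZ μ B l).1 (B.rem S q.2)) (v, x) =
          (B.nb x).1.indicator (fun _ => (hZ μ B l).1 (B.rem S x)) v := by
        intro v
        have h3 : (v, x) ∈ {q : E × E | q.2 ∈ S.1 ∧ q ∈ B.R} ↔ v ∈ (B.nb x).1 := by
          change (x ∈ S.1 ∧ (v, x) ∈ B.R) ↔ (x, v) ∈ B.R
          exact ⟨fun h => B.symm _ _ h.2, fun h => ⟨hx, B.symm _ _ h⟩⟩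
        simp only [Set.indicator]
        congr 1
        exact propext h3
      simp only [this]
      rw [lintegral_indicator (B.nb x).2, setLIntegral_const, mul_comm]
      refine mul_le_mul_left ?_ _
      exact (Measure.restrict_apply_le _ _).trans (hnb x)
    · rw [Set.indicator_of_notMem hx]
      apply le_of_eq
      have : ∀ v, {q : E × E | q.2 ∈ S.1 ∧ q ∈ B.R}.indicator
          (fun q => (hZ μ B l).1 (B.rem S q.2)) (v, x) = 0 := by
        intro v
        apply Set.indicator_of_notMem
        exact fun h => hx h.1
      simp only [this, lintegral_zero]
  calc _ = ∫⁻ _ in S.1, ENNReal.ofReal (1 + t) * (hZ μ B l).1 S ∂μ := by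
          rw [setLIntegral_const]
    _ ≤ _ := lintegral_mono h1
    _ = _ := by
        rw [lintegral_add_left ((B.meas_rem S _).const_mul _),
            lintegral_const_mul _ (B.meas_rem S _), lintegral_const_mul]
        simp only [heq]
        exact hmeas.lintegral_prod_right'
    _ ≤ _ := by
        rw [add_mul, mul_assoc]
        gcongr

/-- existence of a large index with a non-negligible weight -/
lemma exists_index (l : ℝ) (hl : 0 ≤ l) (S : HSet E) (hS : μ S.1 ≠ ∞) (k : ℕ)
    (h : ((k : ℝ≥0∞) + 2) * (hZ μ B l).1 S <
      ENNReal.ofReal l * ∫⁻ x in S.1, (hZ μ B l).1 (B.rem S x) ∂μ) :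
    ∃ K, k ≤ K ∧ (2⁻¹ : ℝ≥0∞) ^ K ≤ hc l K * (hM μ B K).1 S := by
  by_contra! hcon
  apply absurd h
  rw [not_lt]
  have h1 : ENNReal.ofReal l * ∫⁻ x in S.1, (hZ μ B l).1 (B.rem S x) ∂μ =
      ∑' j : ℕ, ((j + 1 : ℕ) : ℝ≥0∞) * (hc l (j + 1) * (hM μ B (j + 1)).1 S) := by
    simp only [hZ_apply]
    rw [lintegral_tsum fun j => ((B.meas_rem S _).const_mul _).aemeasurable,
      ← ENNReal.tsum_mul_left]
    refine tsum_congr fun j => ?_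
    rw [lintegral_const_mul _ (B.meas_rem S _), ← hM_succ, ← mul_assoc, ← mul_assoc]
    congr 1
    unfold hc
    rw [← ENNReal.ofReal_mul hl, ← ENNReal.ofReal_natCast, ← ENNReal.ofReal_mul (by positivity)]
    congr 1
    rw [Nat.factorial_succ]
    push_cast
    have : ((j.factorial : ℕ) : ℝ) ≠ 0 := by exact_mod_cast Nat.factorial_ne_zero j
    field_simp
    ring
  have h2 : ∀ j : ℕ, ((j + 1 : ℕ) : ℝ≥0∞) * (hc l (j + 1) * (hM μ B (j + 1)).1 S) ≤
      k * (hc l (j + 1) * (hM μ B (j + 1)).1 S) +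
        ENNReal.ofReal (((j + 1 : ℕ) : ℝ) * (1 / 2) ^ (j + 1)) := by
    intro j
    rcases le_or_gt (j + 1) k with hj | hj
    · refine le_trans ?_ le_self_add
      gcongr
    · refine le_trans ?_ le_add_self
      rw [ENNReal.ofReal_mul (by positivity), ENNReal.ofReal_natCast]
      refine mul_le_mul_right ((hcon (j + 1) hj.le).le.trans (le_of_eq ?_)) _
      rw [ENNReal.ofReal_pow (by norm_num)]
      congr 1
      rw [one_div, ENNReal.ofReal_inv_of_pos (by norm_num)]
      norm_num
  have h3 : ∑' j : ℕ, ENNReal.ofReal (((j + 1 : ℕ) : ℝ) * (1 / 2) ^ (j + 1)) = 2 := by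
    have h4 : HasSum (fun j : ℕ => (j : ℝ) * (1 / 2) ^ j) 2 := by
      have := hasSum_coe_mul_geometric_of_norm_lt_one (r := (1 / 2 : ℝ)) (by norm_num)
      norm_num at this
      norm_num
      exact this
    have h5 := (hasSum_nat_add_iff' 1).mpr h4
    simp only [Finset.range_one, Finset.sum_singleton, Nat.cast_zero, zero_mul, sub_zero] at h5
    rw [← ENNReal.ofReal_tsum_of_nonneg (fun j => by positivity) h5.summable, h5.tsum_eq]
    norm_num
  rw [h1]
  refine (ENNReal.tsum_le_tsum h2).trans ?_
  rw [ENNReal.tsum_add, h3, ENNReal.tsum_mul_left, add_mul]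
  refine add_le_add (mul_le_mul_right ?_ _) ?_
  · rw [hZ_apply]
    exact ENNReal.tsum_comp_le_tsum_of_injective (add_left_injective 1) _
  · calc (2 : ℝ≥0∞) = 2 * 1 := by rw [mul_one]
      _ ≤ _ := mul_le_mul_right (one_le_hZ μ B l S) _

end Abstract

section Concrete
open scoped ENNReal

/-- shorthand for Euclidean space -/
abbrev EE (d : ℕ) := EuclideanSpace ℝ (Fin d)

lemma rd_pos (d : ℕ) : 0 < rd d := by
  unfold rd
  apply Real.rpow_pos_of_pos
  apply ENNReal.toReal_pos
  · exact (Metric.measure_closedBall_pos volume _ one_pos).ne'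
  · exact measure_closedBall_lt_top.ne

lemma vol_ball (d : ℕ) (hd : 1 ≤ d) (x : EE d) (s : ℝ) (hs : 0 ≤ s) :
    volume (Metric.closedBall x (s * rd d)) = ENNReal.ofReal (s ^ d) := by
  have hr := rd_pos d
  rw [Measure.addHaar_closedBall' _ _ (by positivity), finrank_euclideanSpace_fin]
  set v := volume (Metric.closedBall (0 : EE d) 1) with hv
  have hvt : v ≠ ∞ := measure_closedBall_lt_top.ne
  have hv0 : 0 < v.toReal :=
    ENNReal.toReal_pos (Metric.measure_closedBall_pos volume _ one_pos).ne' hvt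
  have hd0 : (d : ℝ) ≠ 0 := by exact_mod_cast (by omega : d ≠ 0)
  have h1 : rd d ^ d = v.toReal⁻¹ := by
    unfold rd
    rw [← hv, ← Real.rpow_natCast, ← Real.rpow_mul hv0.le, div_mul_cancel₀ _ hd0,
      Real.rpow_neg_one]
  rw [mul_pow, h1, ← ENNReal.ofReal_toReal hvt, ← ENNReal.ofReal_mul (by positivity),
    ENNReal.toReal_ofReal hv0.le]
  congr 1
  field_simp

/-- hard sphere exclusion -/
noncomputable def HB (d : ℕ) : HExcl (EE d) where
  R := {q | dist q.1 q.2 ≤ 2 * rd d}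
  meas := measurableSet_le (measurable_fst.dist measurable_snd) measurable_const
  symm := fun x y h => by
    change dist y x ≤ _
    rw [dist_comm]
    exact h

lemma HB_nb (d : ℕ) (x : EE d) : ((HB d).nb x).1 = Metric.closedBall x (2 * rd d) := by
  ext y
  rw [Metric.mem_closedBall, dist_comm]
  rfl

lemma HB_nb_vol (d : ℕ) (hd : 1 ≤ d) (x : EE d) :
    volume ((HB d).nb x).1 ≤ ENNReal.ofReal (2 ^ d) := by
  rw [HB_nb, vol_ball d hd x 2 (by norm_num)]

lemma ball_geo (d : ℕ) (v x y : EE d) (hx : dist v x ≤ 2 * rd d) (hxy : dist x y ≤ 2 * rd d)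
    (hy : dist v y ≤ dist v x) :
    y ∈ Metric.closedBall (midpoint ℝ v x) (Real.sqrt 3 * rd d) := by
  have hr := rd_pos d
  rw [Metric.mem_closedBall]
  apply le_of_sq_le_sq _ (by positivity)
  rw [mul_pow, Real.sq_sqrt (by norm_num)]
  have h := EuclideanGeometry.dist_sq_add_dist_sq_eq_two_mul_dist_midpoint_sq_add_half_dist_sq y v x
  have a1 : dist v x ^ 2 ≤ (2 * rd d) ^ 2 := by gcongr
  have a2 : dist x y ^ 2 ≤ (2 * rd d) ^ 2 := by gcongr
  have a3 : dist v y ^ 2 ≤ dist v x ^ 2 := by gcongr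
  rw [dist_comm y v, dist_comm y x] at h
  nlinarith

lemma HB_geo (d : ℕ) (hd : 1 ≤ d) (v : EE d) (T : HSet (EE d)) (hT : T.1 ⊆ ((HB d).nb v).1) :
    ∫⁻ x in T.1, volume (T.1 ∩ ((HB d).nb x).1) ≤
      ENNReal.ofReal (2 * Real.sqrt 3 ^ d) * volume T.1 := by
  set G : Set (EE d × EE d) := {q | (q.1 ∈ T.1 ∧ q.2 ∈ T.1) ∧ dist q.1 q.2 ≤ 2 * rd d ∧
    dist v q.2 ≤ dist v q.1} with hG
  have hGm : MeasurableSet G := by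
    refine ((measurable_fst T.2).inter (measurable_snd T.2)).inter
      (MeasurableSet.inter ?_ ?_)
    · exact measurableSet_le (measurable_fst.dist measurable_snd) measurable_const
    · exact measurableSet_le (measurable_const.dist measurable_snd)
        (measurable_const.dist measurable_fst)
  have h1 : ∀ x, volume (Prod.mk x ⁻¹' G) ≤
      T.1.indicator (fun _ => ENNReal.ofReal (Real.sqrt 3 ^ d)) x := by
    intro x
    by_cases hx : x ∈ T.1
    · rw [Set.indicator_of_mem hx, ← vol_ball d hd (midpoint ℝ v x) _ (Real.sqrt_nonneg 3)]
      apply measure_mono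
      rintro y ⟨-, h2, h3⟩
      exact ball_geo d v x y (hT hx) h2 h3
    · have : Prod.mk x ⁻¹' G = ∅ := by
        apply Set.eq_empty_of_forall_notMem
        rintro y ⟨⟨h, -⟩, -⟩
        exact hx h
      rw [this]
      simp
  have h2 : (volume.prod volume) G ≤ ENNReal.ofReal (Real.sqrt 3 ^ d) * volume T.1 := by
    rw [Measure.prod_apply hGm]
    refine (lintegral_mono h1).trans ?_
    rw [lintegral_indicator T.2, setLIntegral_const]
  have h3 : ∀ x, T.1.indicator (fun x => volume (T.1 ∩ ((HB d).nb x).1)) x ≤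
      volume (Prod.mk x ⁻¹' G) + volume ((fun y => (y, x)) ⁻¹' G) := by
    intro x
    by_cases hx : x ∈ T.1
    · rw [Set.indicator_of_mem hx]
      refine le_trans (measure_mono ?_) (measure_union_le _ _)
      rintro y ⟨hy, hxy⟩
      rcases le_total (dist v y) (dist v x) with h | h
      · left
        exact ⟨⟨hx, hy⟩, hxy, h⟩
      · right
        refine ⟨⟨hy, hx⟩, ?_, h⟩
        change dist y x ≤ _
        rw [dist_comm]
        exact hxy
    · rw [Set.indicator_of_notMem hx]
      exact zero_le
  rw [← lintegral_indicator T.2]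
  refine (lintegral_mono h3).trans ?_
  rw [lintegral_add_left (measurable_measure_prodMk_left hGm), ← Measure.prod_apply hGm,
    ← Measure.prod_apply_symm hGm, ENNReal.ofReal_mul (by norm_num), ENNReal.ofReal_ofNat,
    mul_assoc, two_mul]
  exact add_le_add h2 h2

lemma packSet_meas (d k : ℕ) (S : HSet (EE d)) : MeasurableSet (packSet d k S.1) := by
  have : packSet d k S.1 = (⋂ i, (fun x : Fin k → EE d => x i) ⁻¹' S.1) ∩
      ⋂ i, ⋂ j, {x | i ≠ j → dist (x i) (x j) > 2 * rd d} := by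
    ext x
    simp [packSet]
  rw [this]
  refine (MeasurableSet.iInter fun i => measurable_pi_apply i S.2).inter
    (MeasurableSet.iInter fun i => MeasurableSet.iInter fun j => ?_)
  by_cases hij : i = j
  · simp [hij]
  · simp only [ne_eq, hij, not_false_eq_true, forall_const]
    exact measurableSet_lt measurable_const
      ((measurable_pi_apply i).dist (measurable_pi_apply j))

lemma packSet_succ (d k : ℕ) (S : HSet (EE d)) (x : Fin (k + 1) → EE d) :
    x ∈ packSet d (k + 1) S.1 ↔ x 0 ∈ S.1 ∧
      (fun i : Fin k => x i.succ) ∈ packSet d k ((HB d).rem S (x 0)).1 := by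
  have hrem : ∀ y z : EE d, z ∈ ((HB d).rem S y).1 ↔ z ∈ S.1 ∧ dist y z > 2 * rd d := by
    intro y z
    rw [gt_iff_lt, ← not_le]
    rfl
  constructor
  · rintro ⟨h1, h2⟩
    refine ⟨h1 0, fun i => (hrem _ _).2 ⟨h1 _, h2 _ _ (Fin.succ_ne_zero i).symm⟩, fun i j hij => ?_⟩
    exact h2 _ _ (fun h => hij (Fin.succ_injective _ h))
  · rintro ⟨h0, h1, h2⟩
    refine ⟨fun i => ?_, fun i j hij => ?_⟩
    · refine Fin.cases h0 (fun i => ?_) i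
      exact ((hrem _ _).1 (h1 i)).1
    · induction i using Fin.cases with
      | zero =>
        induction j using Fin.cases with
        | zero => exact absurd rfl hij
        | succ j => exact ((hrem _ _).1 (h1 j)).2
      | succ i =>
        induction j using Fin.cases with
        | zero =>
          rw [dist_comm]
          exact ((hrem _ _).1 (h1 i)).2
        | succ j => exact h2 i j (fun h => hij (by rw [h]))

lemma vol_packSet (d k : ℕ) (S : HSet (EE d)) :
    volume (packSet d k S.1) = (hM volume (HB d) k).1 S := by
  induction k generalizing S with
  | zero =>
    have : packSet d 0 S.1 = Set.univ := by
      ext x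
      simp [packSet]
    rw [this, hM_zero, volume_pi]
    simp
  | succ k ih =>
    rw [hM_succ]
    have hp := volume_preserving_piFinSuccAbove (fun _ : Fin (k + 1) => EE d) 0
    set P : Set (EE d × (Fin k → EE d)) :=
      {q | q.1 ∈ S.1 ∧ q.2 ∈ packSet d k ((HB d).rem S q.1).1} with hP
    have hpre : packSet d (k + 1) S.1 =
        (MeasurableEquiv.piFinSuccAbove (fun _ : Fin (k + 1) => EE d) 0) ⁻¹' P := by
      ext x
      rw [packSet_succ]
      rfl
    have hPm : MeasurableSet P := by
      have := packSet_meas d (k + 1) S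
      rw [hpre] at this
      exact (MeasurableEquiv.measurableSet_preimage _).1 this
    rw [hpre, hp.measure_preimage_equiv, Measure.volume_eq_prod, Measure.prod_apply hPm,
      ← lintegral_indicator S.2]
    refine lintegral_congr fun x => ?_
    by_cases hx : x ∈ S.1
    · rw [Set.indicator_of_mem hx, ← ih]
      congr 1
      ext y
      exact and_iff_right hx
    · rw [Set.indicator_of_notMem hx]
      have : Prod.mk x ⁻¹' P = ∅ := by
        apply Set.eq_empty_of_forall_notMem
        rintro y ⟨h, -⟩
        exact hx h
      rw [this, measure_empty]

lemma Zhat_eq (d k : ℕ) (S : HSet (EE d)) :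
    Zhat d S.1 k * (Nat.factorial k : ℝ) = ((hM volume (HB d) k).1 S).toReal := by
  unfold Zhat
  have h0 : (Nat.factorial k : ℝ) ≠ 0 := by exact_mod_cast Nat.factorial_ne_zero k
  rw [integral_indicator_const _ (packSet_meas d k S), measureReal_def, vol_packSet, smul_eq_mul]
  field_simp

end Concrete

section Final
open scoped ENNReal

/-- the constant `log (2/√3)` -/
noncomputable def cc : ℝ := Real.log (2 / Real.sqrt 3)

lemma sqrt3_lt : Real.sqrt 3 < 2 := by
  rw [Real.sqrt_lt' (by norm_num)]
  norm_num

lemma sqrt3_pos : 0 < Real.sqrt 3 := Real.sqrt_pos.2 (by norm_num)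

lemma cc_pos : 0 < cc := by
  unfold cc
  apply Real.log_pos
  rw [lt_div_iff₀ sqrt3_pos, one_mul]
  exact sqrt3_lt

/-- the exponent parameter -/
noncomputable def tt (d : ℕ) : ℝ := d * cc - 2 * Real.log d

/-- denominators -/
noncomputable def qq (d : ℕ) : ℝ := 1 / d + Real.exp (2 / d)

/-- the density -/
noncomputable def aa (d : ℕ) : ℝ := (2 ^ d)⁻¹ * (tt d / qq d)

lemma qq_pos (d : ℕ) : 0 < qq d := by
  unfold qq
  positivity

lemma tt_ratio : Tendsto (fun d : ℕ => tt d / (cc * d)) atTop (nhds 1) := by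
  have h := (Real.isLittleO_log_id_atTop.tendsto_div_nhds_zero).comp
    (tendsto_natCast_atTop_atTop (R := ℝ))
  have h2 : Tendsto (fun d : ℕ => 1 - 2 / cc * (Real.log d / d)) atTop
      (nhds (1 - 2 / cc * 0)) := by
    refine tendsto_const_nhds.sub (tendsto_const_nhds.mul ?_)
    exact h
  rw [mul_zero, sub_zero] at h2
  refine h2.congr' ?_
  filter_upwards [eventually_ge_atTop 1] with d hd
  have hd0 : (d : ℝ) ≠ 0 := by exact_mod_cast (by omega : d ≠ 0)
  have := cc_pos.ne'
  unfold tt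
  field_simp

lemma qq_lim : Tendsto qq atTop (nhds 1) := by
  have h1 : Tendsto (fun d : ℕ => (1 : ℝ) / d) atTop (nhds 0) := tendsto_one_div_atTop_nhds_zero_nat
  have h2 : Tendsto (fun d : ℕ => (2 : ℝ) / d) atTop (nhds 0) := tendsto_const_div_atTop_nhds_zero_nat 2
  have h3 := (Real.continuous_exp.tendsto 0).comp h2
  have := h1.add h3
  rw [zero_add, Real.exp_zero] at this
  exact this

lemma aa_lim : Tendsto (fun d : ℕ => aa d * 2 ^ d / (cc * d)) atTop (nhds 1) := by
  have h := tt_ratio.div qq_lim one_ne_zero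
  rw [div_one] at h
  refine h.congr fun d => ?_
  simp only [Pi.div_apply]
  unfold aa
  have := (qq_pos d).ne'
  have h2 : (2 : ℝ) ^ d ≠ 0 := by positivity
  field_simp

lemma tt_top : Tendsto tt atTop atTop := by
  have h1 : Tendsto (fun d : ℕ => cc * (d : ℝ)) atTop atTop :=
    (tendsto_natCast_atTop_atTop (R := ℝ)).const_mul_atTop cc_pos
  have h2 := tt_ratio.pos_mul_atTop one_pos h1
  refine h2.congr' ?_
  filter_upwards [eventually_ge_atTop 1] with d hd
  have hd0 : (d : ℝ) ≠ 0 := by exact_mod_cast (by omega : d ≠ 0)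
  have := cc_pos.ne'
  field_simp

/-- fugacity -/
noncomputable def ll (d : ℕ) : ℝ := (Real.sqrt 3 ^ d * d)⁻¹

lemma exp_cc (d : ℕ) : Real.exp (d * cc) = 2 ^ d / Real.sqrt 3 ^ d := by
  rw [mul_comm, Real.exp_mul, cc, Real.exp_log (div_pos two_pos sqrt3_pos), Real.rpow_natCast,
    div_pow]

lemma exp_tt (d : ℕ) (hd : 1 ≤ d) : Real.exp (tt d) = ll d * 2 ^ d / d := by
  have hd0 : (0 : ℝ) < d := by exact_mod_cast (by omega : 0 < d)
  unfold tt ll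
  rw [Real.exp_sub, exp_cc, mul_comm 2, Real.exp_mul, Real.exp_log hd0]
  have := sqrt3_pos
  norm_num
  field_simp

lemma Bn_vol (d : ℕ) (hd : 1 ≤ d) (n : ℝ) (hn : 0 ≤ n) : volume (Bn d n) = ENNReal.ofReal n := by
  unfold Bn
  rw [vol_ball d hd _ _ (by positivity)]
  congr 1
  have hd0 : (d : ℝ) ≠ 0 := by exact_mod_cast (by omega : d ≠ 0)
  rw [← Real.rpow_natCast, ← Real.rpow_mul hn, one_div_mul_cancel hd0, Real.rpow_one]

/-- the ball as a measurable set -/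
noncomputable def hBn (d : ℕ) (n : ℝ) : HSet (EE d) := ⟨Bn d n, Metric.isClosed_closedBall.measurableSet⟩

lemma key_bound (d : ℕ) (hd : 1 ≤ d) (ht : 1 ≤ tt d) (n : ℝ) (hn : 0 < n) (k : ℕ)
    (hk1 : 1 ≤ k) (hk : (k : ℝ) ≤ aa d * n) (hbig : 2 < (2 ^ d)⁻¹ * (1 / qq d) * n) :
    ((k : ℝ) / (2 * Real.exp 1 * ll d)) ^ k ≤ ((hM volume (HB d) k).1 (hBn d n)).toReal := by
  have hd0 : (0 : ℝ) < d := by exact_mod_cast (by omega : 0 < d)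
  have hs3 := sqrt3_pos
  have hl : 0 < ll d := by unfold ll; positivity
  have hq := qq_pos d
  have hvol : volume (hBn d n).1 = ENNReal.ofReal n := Bn_vol d hd n hn.le
  have hvt : volume (hBn d n).1 ≠ ∞ := by rw [hvol]; exact ENNReal.ofReal_ne_top
  have hmain := hZ_main volume (HB d) (ll d) hl.le (2 * Real.sqrt 3 ^ d) (by positivity)
    (ENNReal.ofReal (2 ^ d)) ENNReal.ofReal_ne_top (HB_nb_vol d hd)
    (fun v T hT => HB_geo d hd v T hT) (tt d) (by linarith) (hBn d n)
  have hFt := hF_ne_top volume (HB d) (ll d) hl.le (hBn d n) hvt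
  have hZt := hZ_ne_top volume (HB d) (ll d) hl.le (hBn d n) hvt
  have hZ1 := one_le_hZ volume (HB d) (ll d) (hBn d n)
  have hidx := exists_index volume (HB d) (ll d) hl.le (hBn d n) hvt k
  set F := ∫⁻ x in (hBn d n).1, (hZ volume (HB d) (ll d)).1 ((HB d).rem (hBn d n) x) with hF
  set Z := (hZ volume (HB d) (ll d)).1 (hBn d n) with hZ
  have hz1 : 1 ≤ Z.toReal := by
    have := ENNReal.toReal_mono hZt hZ1
    simpa using this
  have hf0 : 0 ≤ F.toReal := ENNReal.toReal_nonneg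
  have hls : ll d * (2 * Real.sqrt 3 ^ d) = 2 / d := by
    unfold ll
    field_simp
  rw [hls, exp_tt d hd, hvol, ← ENNReal.ofReal_toReal hZt, ← ENNReal.ofReal_toReal hFt,
    ← ENNReal.ofReal_mul (by linarith), ← ENNReal.ofReal_mul (by positivity),
    ← ENNReal.ofReal_mul (by positivity), ← ENNReal.ofReal_add (by positivity) (by positivity),
    ← ENNReal.ofReal_mul (by positivity), ENNReal.ofReal_le_ofReal_iff (by positivity)] at hmain
  have h2d : (0 : ℝ) < 2 ^ d := by positivity
  have e1 : (ll d * 2 ^ d / d + ll d * Real.exp (2 / d) * 2 ^ d) * F.toReal =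
      (ll d * F.toReal) * (2 ^ d * qq d) := by
    unfold qq
    ring
  rw [e1] at hmain
  have h3 : ((k : ℝ) + 2) * Z.toReal < ll d * F.toReal := by
    have h4 : (1 + tt d) * Z.toReal * n / (2 ^ d * qq d) ≤ ll d * F.toReal := by
      rw [div_le_iff₀ (by positivity)]
      exact hmain
    refine lt_of_lt_of_le ?_ h4
    have e2 : (1 + tt d) * Z.toReal * n / (2 ^ d * qq d) =
        (aa d * n + (2 ^ d)⁻¹ * (1 / qq d) * n) * Z.toReal := by
      unfold aa
      field_simp
      ring
    rw [e2]
    apply mul_lt_mul_of_pos_right _ (by linarith)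
    linarith
  obtain ⟨K, hkK, hK⟩ := hidx (by
    rw [← ENNReal.ofReal_toReal hZt, ← ENNReal.ofReal_toReal hFt,
      ← ENNReal.ofReal_mul hl.le]
    have e3 : ((k : ℝ≥0∞) + 2) = ENNReal.ofReal ((k : ℝ) + 2) := by
      rw [ENNReal.ofReal_add (by positivity) (by norm_num), ENNReal.ofReal_natCast,
        ENNReal.ofReal_ofNat]
    rw [e3, ← ENNReal.ofReal_mul (by positivity)]
    exact (ENNReal.ofReal_lt_ofReal_iff_of_nonneg (by positivity)).2 h3)
  have hMt : ∀ j, (hM volume (HB d) j).1 (hBn d n) ≠ ∞ := fun j =>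
    ne_top_of_le_ne_top (ENNReal.pow_ne_top hvt) (hM_le volume (HB d) j (hBn d n))
  have hKr : (2⁻¹ : ℝ) ^ K ≤ ll d ^ K / K.factorial * ((hM volume (HB d) K).1 (hBn d n)).toReal := by
    have hcK : (hc (ll d) K).toReal = ll d ^ K / K.factorial :=
      ENNReal.toReal_ofReal (by positivity)
    have hne : hc (ll d) K * (hM volume (HB d) K).1 (hBn d n) ≠ ⊤ :=
      ENNReal.mul_ne_top ENNReal.ofReal_ne_top (hMt K)
    have := ENNReal.toReal_mono hne hK
    rw [ENNReal.toReal_mul, hcK, ENNReal.toReal_pow, ENNReal.toReal_inv] at this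
    simpa using this
  have hfact : (K : ℝ) ^ K / K.factorial ≤ Real.exp 1 ^ K := by
    have := Real.pow_div_factorial_le_exp (x := (K : ℝ)) (by positivity) K
    rwa [← Real.exp_nat_mul, mul_one]
  have hfpos : (0 : ℝ) < K.factorial := by exact_mod_cast Nat.factorial_pos K
  have hqK : ((k : ℝ) / (2 * Real.exp 1 * ll d)) ^ K ≤
      ((hM volume (HB d) K).1 (hBn d n)).toReal := by
    set m := ((hM volume (HB d) K).1 (hBn d n)).toReal
    have hm0 : 0 ≤ m := ENNReal.toReal_nonneg
    have hkK' : (k : ℝ) ≤ K := by exact_mod_cast hkK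
    rw [div_pow, div_le_iff₀ (by positivity)]
    rw [div_le_iff₀ hfpos] at hfact
    have a1 : (K.factorial : ℝ) ≤ (2 * ll d) ^ K * m := by
      rw [mul_pow]
      rw [inv_pow, inv_le_iff_one_le_mul₀ (by positivity), div_mul_eq_mul_div,
        div_mul_eq_mul_div, one_le_div hfpos] at hKr
      linarith
    calc (k : ℝ) ^ K ≤ (K : ℝ) ^ K := by gcongr
      _ ≤ Real.exp 1 ^ K * K.factorial := hfact
      _ ≤ Real.exp 1 ^ K * ((2 * ll d) ^ K * m) := by gcongr
      _ = _ := by rw [mul_pow, mul_pow, mul_pow]; ring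
  have hfin := hM_pow_le volume (HB d) k K hk1 hkK (hBn d n)
    (ENNReal.ofReal ((k : ℝ) / (2 * Real.exp 1 * ll d))) (by
      rw [← ENNReal.ofReal_pow (by positivity)]
      exact ENNReal.ofReal_le_of_le_toReal hqK)
  have := ENNReal.toReal_mono (hMt k) hfin
  rwa [← ENNReal.ofReal_pow (by positivity), ENNReal.toReal_ofReal (by positivity)] at this

lemma log_bound (d : ℕ) (hd : 1 ≤ d) (ht : 1 ≤ tt d)
    (hd4 : 4 * Real.exp 1 * (1 + Real.exp 2) ≤ d) (n : ℝ) (hn : 0 < n)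
    (han : 2 ≤ aa d * n) (hbig : 2 < (2 ^ d)⁻¹ * (1 / qq d) * n) :
    -(cc * d) ≤ (1 / (aa d * n)) *
      Real.log (Zhat d (Bn d n) ⌊aa d * n⌋₊ * (Nat.factorial ⌊aa d * n⌋₊ : ℝ)
        / n ^ ⌊aa d * n⌋₊) := by
  have hd0 : (0 : ℝ) < d := by exact_mod_cast (by omega : 0 < d)
  have hd1 : (1 : ℝ) ≤ d := by exact_mod_cast hd
  have hs3 := sqrt3_pos
  have hl : 0 < ll d := by unfold ll; positivity
  have hq := qq_pos d
  have hc := cc_pos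
  set k := ⌊aa d * n⌋₊ with hkdef
  have hk : (k : ℝ) ≤ aa d * n := Nat.floor_le (by linarith)
  have hk1 : 1 ≤ k := Nat.le_floor (by push_cast; linarith)
  have hk2 : aa d * n / 2 ≤ k := by
    have := Nat.lt_floor_add_one (aa d * n)
    rw [← hkdef] at this
    linarith
  have hkey := key_bound d hd ht n hn k hk1 hk hbig
  have hz : Zhat d (Bn d n) k * (Nat.factorial k : ℝ) =
    ((hM volume (HB d) k).1 (hBn d n)).toReal := Zhat_eq d k (hBn d n)
  rw [hz]
  have hbase : Real.exp (-(cc * d)) ≤ (k : ℝ) / (2 * Real.exp 1 * ll d) / n := by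
    rw [mul_comm cc, Real.exp_neg, exp_cc, inv_div]
    rw [le_div_iff₀ hn, le_div_iff₀ (by positivity)]
    refine le_trans ?_ hk2
    have hqq : qq d ≤ 1 + Real.exp 2 := by
      unfold qq
      refine add_le_add ?_ (Real.exp_le_exp.2 ?_)
      · rw [div_le_one hd0]; exact hd1
      · rw [div_le_iff₀ hd0]; linarith
    have h1 : 4 * Real.exp 1 * qq d ≤ tt d * d := by
      calc _ ≤ 4 * Real.exp 1 * (1 + Real.exp 2) := by gcongr
        _ ≤ d := hd4
        _ ≤ tt d * d := le_mul_of_one_le_left hd0.le ht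
    unfold aa ll
    rw [le_div_iff₀ two_pos]
    have e1 : Real.sqrt 3 ^ d / 2 ^ d * n * (2 * Real.exp 1 * (Real.sqrt 3 ^ d * d)⁻¹) * 2 =
        n * (2 ^ d)⁻¹ * ((4 * Real.exp 1) / d) := by
      field_simp
      ring
    have e2 : (2 ^ d)⁻¹ * (tt d / qq d) * n = n * (2 ^ d)⁻¹ * (tt d / qq d) := by ring
    rw [e1, e2]
    apply mul_le_mul_of_nonneg_left _ (by positivity)
    rw [div_le_div_iff₀ hd0 hq]
    exact h1
  have hlog : (k : ℝ) * -(cc * d) ≤ Real.log (((hM volume (HB d) k).1 (hBn d n)).toReal / n ^ k) := by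
    rw [← Real.log_exp (k * -(cc * d))]
    apply Real.log_le_log (Real.exp_pos _)
    rw [Real.exp_nat_mul]
    calc _ ≤ ((k : ℝ) / (2 * Real.exp 1 * ll d) / n) ^ k := by gcongr
      _ = ((k : ℝ) / (2 * Real.exp 1 * ll d)) ^ k / n ^ k := div_pow _ _ _
      _ ≤ _ := by gcongr
  rw [one_div, ← div_eq_inv_mul, le_div_iff₀ (by linarith)]
  refine le_trans ?_ hlog
  have : 0 < cc * d := by positivity
  nlinarith

lemma log_nonpos (d : ℕ) (hd : 1 ≤ d) (n : ℝ) (hn : 0 < n) (han : 0 ≤ aa d * n) :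
    (1 / (aa d * n)) *
      Real.log (Zhat d (Bn d n) ⌊aa d * n⌋₊ * (Nat.factorial ⌊aa d * n⌋₊ : ℝ)
        / n ^ ⌊aa d * n⌋₊) ≤ 0 := by
  set k := ⌊aa d * n⌋₊ with hkdef
  have hz : Zhat d (Bn d n) k * (Nat.factorial k : ℝ) =
    ((hM volume (HB d) k).1 (hBn d n)).toReal := Zhat_eq d k (hBn d n)
  rw [hz]
  have hvol : volume (hBn d n).1 = ENNReal.ofReal n := Bn_vol d hd n hn.le
  have h1 : ((hM volume (HB d) k).1 (hBn d n)).toReal ≤ n ^ k := by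
    have := hM_le volume (HB d) k (hBn d n)
    rw [hvol, ← ENNReal.ofReal_pow hn.le] at this
    exact ENNReal.toReal_le_of_le_ofReal (by positivity) this
  apply mul_nonpos_of_nonneg_of_nonpos (by positivity)
  apply Real.log_nonpos (div_nonneg ENNReal.toReal_nonneg (by positivity))
  rw [div_le_one (by positivity)]
  exact h1

end Final

/-- there is a density `α(d) = (1 + o_d(1)) log(2/√3) d 2^{-d}` at which the
entropy density satisfies `f_d(α) ≥ -(1 + o_d(1)) log(2/√3) d`. -/
theorem hard_sphere_entropy_lower_bound :
    ∃ α : ℕ → ℝ,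
      Filter.Tendsto (fun d : ℕ => α d * 2 ^ d / (Real.log (2 / Real.sqrt 3) * d))
        Filter.atTop (nhds 1) ∧
      ∀ ε : ℝ, 0 < ε → ∃ d₀ : ℕ, ∀ d : ℕ, d₀ ≤ d →
        Filter.liminf
            (fun n : ℝ => (1 / (α d * n)) *
              Real.log (Zhat d (Bn d n) ⌊α d * n⌋₊ * (Nat.factorial ⌊α d * n⌋₊ : ℝ)
                / n ^ ⌊α d * n⌋₊))
            Filter.atTop
          ≥ -((1 + ε) * Real.log (2 / Real.sqrt 3) * d) := by
  
  refine ⟨aa, aa_lim, fun ε hε => ?_⟩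
  have hev : ∀ᶠ d : ℕ in atTop, 1 ≤ d ∧ 1 ≤ tt d ∧ 4 * Real.exp 1 * (1 + Real.exp 2) ≤ (d : ℝ) :=
    (eventually_ge_atTop 1).and ((tt_top.eventually_ge_atTop 1).and
      ((tendsto_natCast_atTop_atTop (R := ℝ)).eventually_ge_atTop _))
  obtain ⟨d₀, hd₀⟩ := eventually_atTop.1 hev
  refine ⟨d₀, fun d hdd => ?_⟩
  obtain ⟨hd, ht, hd4⟩ := hd₀ d hdd
  have hc := cc_pos
  have hq := qq_pos d
  have hd0 : (0 : ℝ) < d := by exact_mod_cast (by omega : 0 < d)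
  have ha : 0 < aa d := by
    unfold aa
    have : 0 < tt d := by linarith
    positivity
  have hb : 0 < ((2 : ℝ) ^ d)⁻¹ * (1 / qq d) := by positivity
  have e1 : ∀ᶠ n : ℝ in atTop, 2 ≤ aa d * n :=
    (tendsto_id.const_mul_atTop ha).eventually_ge_atTop 2
  have e2 : ∀ᶠ n : ℝ in atTop, 2 < ((2 : ℝ) ^ d)⁻¹ * (1 / qq d) * n :=
    (tendsto_id.const_mul_atTop hb).eventually_gt_atTop 2
  refine le_liminf_of_le ?_ ?_
  · apply IsBoundedUnder.isCoboundedUnder_ge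
    refine ⟨0, ?_⟩
    rw [eventually_map]
    filter_upwards [e1, eventually_gt_atTop 0] with n h1 hn
    exact log_nonpos d hd n hn (by linarith)
  · filter_upwards [e1, e2, eventually_gt_atTop 0] with n h1 h2 hn
    refine le_trans ?_ (log_bound d hd ht hd4 n hn h1 h2)
    change -((1 + ε) * cc * d) ≤ -(cc * d)
    have : 0 < cc * d := by positivity
    nlinarith
end

section
/- Let S ⊆ ℝ^d be bounded, measurable, and of positive volume, and let λ > 0. Then vol(S) · α_S(λ) = λ · E_{S,λ}[ vol({x ∈ S : |x − y| > 2 r_d for all y ∈ X}) ]; that is, the expected packing density equals λ times the expected free volume fraction: α_S(λ) = λ · FV_S(λ). -/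
open MeasureTheory Filter

lemma measurableSet_packSet (d k : ℕ) (S : Set (EuclideanSpace ℝ (Fin d)))
    (hM : MeasurableSet S) : MeasurableSet (packSet d k S) := by
  have h : packSet d k S = (⋂ i, (fun x => x i) ⁻¹' S) ∩
      ⋂ i, ⋂ j, ⋂ (_ : i ≠ j), {x | 2 * rd d < dist (x i) (x j)} := by
    ext x; simp [packSet]
  rw [h]
  refine MeasurableSet.inter ?_ ?_
  · exact MeasurableSet.iInter fun i => (measurable_pi_apply i) hM
  · exact MeasurableSet.iInter fun i => MeasurableSet.iInter fun j => MeasurableSet.iInter fun _ =>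
      (isOpen_lt continuous_const (by fun_prop)).measurableSet

lemma cons_mem_packSet (d k : ℕ) (S : Set (EuclideanSpace ℝ (Fin d)))
    (p : EuclideanSpace ℝ (Fin d)) (y : Fin k → EuclideanSpace ℝ (Fin d)) :
    (Fin.cons p y : Fin (k + 1) → EuclideanSpace ℝ (Fin d)) ∈ packSet d (k + 1) S ↔
      y ∈ packSet d k S ∧ p ∈ S ∧ ∀ i, dist p (y i) > 2 * rd d := by
  simp only [packSet, Set.mem_ofPred_eq, Fin.forall_fin_succ, Fin.cons_zero, Fin.cons_succ]
  constructor
  · rintro ⟨⟨h1, h2⟩, ⟨-, h3⟩, h4⟩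
    exact ⟨⟨h2, fun i j hij => (h4 i).2 j (by simpa using hij)⟩, h1,
      fun i => h3 i (Fin.succ_ne_zero i).symm⟩
  · rintro ⟨⟨h2, h4⟩, h1, h3⟩
    refine ⟨⟨h1, h2⟩, ⟨fun h => absurd rfl h, fun i _ => h3 i⟩, fun i => ⟨fun _ => ?_, fun j hij => ?_⟩⟩
    · rw [dist_comm]; exact h3 i
    · exact h4 i j (by simpa using hij)

lemma integral_packSet_succ (d k : ℕ) (S : Set (EuclideanSpace ℝ (Fin d)))
    (hB : Bornology.IsBounded S) (hM : MeasurableSet S) :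
    ∫ x : Fin (k + 1) → EuclideanSpace ℝ (Fin d),
      Set.indicator (packSet d (k + 1) S) (fun _ => (1 : ℝ)) x =
    ∫ x : Fin k → EuclideanSpace ℝ (Fin d),
      Set.indicator (packSet d k S)
        (fun y => (volume {p | p ∈ S ∧ ∀ i, dist p (y i) > 2 * rd d}).toReal) x := by
  have hP := measurableSet_packSet d (k + 1) S hM
  have hmp := (volume_preserving_piFinSuccAbove
    (fun _ : Fin (k + 1) => EuclideanSpace ℝ (Fin d)) 0).symm
  have hQ := hmp.measurable hP
  set Q := (MeasurableEquiv.piFinSuccAbove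
    (fun _ : Fin (k + 1) => EuclideanSpace ℝ (Fin d)) 0).symm ⁻¹' (packSet d (k + 1) S) with hQdef
  have hslice : ∀ y : Fin k → EuclideanSpace ℝ (Fin d),
      Set.indicator (packSet d k S)
        (fun y => (volume {p | p ∈ S ∧ ∀ i, dist p (y i) > 2 * rd d}).toReal) y =
      (volume ((fun p => (p, y)) ⁻¹' Q)).toReal := by
    intro y
    have hmem : ∀ p, p ∈ (fun p => (p, y)) ⁻¹' Q ↔
        y ∈ packSet d k S ∧ p ∈ S ∧ ∀ i, dist p (y i) > 2 * rd d := by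
      intro p
      rw [← cons_mem_packSet, hQdef]
      simp [MeasurableEquiv.piFinSuccAbove, Fin.insertNthEquiv]
    by_cases hy : y ∈ packSet d k S
    · rw [Set.indicator_of_mem hy]
      congr 2
      ext p
      rw [hmem]
      simp [hy]
    · rw [Set.indicator_of_notMem hy]
      have : (fun p => (p, y)) ⁻¹' Q = ∅ := by
        ext p
        rw [hmem]
        simp [hy]
      simp [this]
  have hfin : ∀ y : Fin k → EuclideanSpace ℝ (Fin d),
      volume ((fun p => (p, y)) ⁻¹' Q) < ⊤ := by
    intro y
    refine lt_of_le_of_lt (measure_mono ?_) hB.measure_lt_top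
    intro p hp
    have h0 := hp.1 0
    simpa [MeasurableEquiv.piFinSuccAbove, Fin.insertNthEquiv] using h0
  simp_rw [hslice]
  rw [integral_toReal (measurable_measure_prodMk_right hQ).aemeasurable
    (Filter.Eventually.of_forall hfin), ← Measure.prod_apply_symm hQ]
  rw [show (fun _ : Fin (k + 1) → EuclideanSpace ℝ (Fin d) => (1 : ℝ)) = 1 from rfl,
    integral_indicator_one hP, Measure.real, ← hmp.measure_preimage hP.nullMeasurableSet]
  rfl

/-- `vol(S) α_S(λ) = λ E_{S,λ}[vol(free volume of X)]`, i.e.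
`α_S(λ) = λ FV_S(λ)`. -/
theorem alphaS_eq_lam_mul_freeVolume (d : ℕ) (S : Set (EuclideanSpace ℝ (Fin d)))
    (hB : Bornology.IsBounded S) (hM : MeasurableSet S) (hv : 0 < volume S)
    (lam : ℝ) (hlam : 0 < lam) :
    (volume S).toReal * alphaS d S lam =
      lam * ((1 / Zgc d S lam) *
        ∑' k : ℕ, (lam ^ k / (Nat.factorial k : ℝ)) *
          ∫ x : Fin k → EuclideanSpace ℝ (Fin d),
            Set.indicator (packSet d k S)
              (fun y => (volume {p | p ∈ S ∧ ∀ i, dist p (y i) > 2 * rd d}).toReal) x) := by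
  have hV : (volume S).toReal ≠ 0 := (ENNReal.toReal_pos hv.ne' hB.measure_lt_top.ne).ne'
  have hterm : ∀ k : ℕ, ((k + 1 : ℕ) : ℝ) * lam ^ (k + 1) * Zhat d S (k + 1) =
      lam * ((lam ^ k / (Nat.factorial k : ℝ)) *
          ∫ x : Fin k → EuclideanSpace ℝ (Fin d),
            Set.indicator (packSet d k S)
              (fun y => (volume {p | p ∈ S ∧ ∀ i, dist p (y i) > 2 * rd d}).toReal) x) := by
    intro k
    rw [Zhat, integral_packSet_succ d k S hB hM, Nat.factorial_succ]
    have h1 : (Nat.factorial k : ℝ) ≠ 0 := by positivity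
    have h2 : ((k + 1 : ℕ) : ℝ) ≠ 0 := by positivity
    push_cast at h2 ⊢
    field_simp
    ring
  have hsum : ∑' k : ℕ, (k : ℝ) * lam ^ k * Zhat d S k =
      ∑' k : ℕ, ((k + 1 : ℕ) : ℝ) * lam ^ (k + 1) * Zhat d S (k + 1) := by
    by_cases hs : Summable fun k : ℕ => ((k + 1 : ℕ) : ℝ) * lam ^ (k + 1) * Zhat d S (k + 1)
    · rw [tsum_eq_zero_add' (f := fun k : ℕ => (k : ℝ) * lam ^ k * Zhat d S k) hs]
      simp
    · rw [tsum_eq_zero_of_not_summable hs, tsum_eq_zero_of_not_summable]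
      intro h
      exact hs ((summable_nat_add_iff (f := fun k : ℕ => (k : ℝ) * lam ^ k * Zhat d S k) 1).2 h)
  rw [alphaS, hsum, tsum_congr hterm, tsum_mul_left, ← div_div, mul_div_assoc',
    mul_div_cancel₀ _ hV]
  ring
end

section
/- Let S ⊆ ℝ^d be bounded, measurable, and of positive volume, and let λ > 0. Then α_S(λ) = λ · E[ 1 / Z_{T(v,X)}(λ) ], where the expectation is over the two-part experiment in which a configuration X is drawn from the hard sphere model on S at fugacity λ and, independently, v is a uniform point of S, and T(v,X) is the externally uncovered region. -/
open MeasureTheory Filter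

open scoped ENNReal

namespace HS

/-- shorthand -/
abbrev E (d : ℕ) := EuclideanSpace ℝ (Fin d)

/-- Packings indexed by a general type. -/
def PK (d : ℕ) (ι : Type) (S : Set (E d)) : Set (ι → E d) :=
  {x | (∀ i, x i ∈ S) ∧ ∀ i j, i ≠ j → dist (x i) (x j) > 2 * rd d}

/-- Uncovered region for a general index type. -/
def TR (d : ℕ) (S : Set (E d)) (v : E d) {ι : Type} (x : ι → E d) : Set (E d) :=
  {p | p ∈ Metric.closedBall v (2 * rd d) ∩ S ∧
    ∀ i, dist (x i) v > 2 * rd d → dist p (x i) > 2 * rd d}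

/-- Extended nonnegative partition function. -/
noncomputable def ZE (d : ℕ) (S : Set (E d)) (L : ℝ≥0∞) : ℝ≥0∞ :=
  ∑' k : ℕ, L ^ k / (k.factorial : ℝ≥0∞) * volume (PK d (Fin k) S)

/-- External configurations. -/
def EX (d : ℕ) (ι : Type) (v : E d) : Set (ι → E d) := {x | ∀ i, 2 * rd d < dist (x i) v}

variable {d : ℕ}

lemma reindex_lint {ι κ : Type} [Fintype ι] [Fintype κ] (e : ι ≃ κ) (f : (κ → E d) → ℝ≥0∞) :
    ∫⁻ x, f x = ∫⁻ x : ι → E d, f (x ∘ e.symm) := by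
  rw [MeasurePreserving.lintegral_map_equiv f _
    (volume_preserving_arrowCongr' e (MeasurableEquiv.refl (E d)) (MeasurePreserving.id _))]
  rfl

lemma measurableSet_PK {ι : Type} [Fintype ι] {S : Set (E d)} (hM : MeasurableSet S) :
    MeasurableSet (PK d ι S) := by
  unfold PK
  simp only [Set.ofPred_and, Set.ofPred_forall]
  refine MeasurableSet.inter ?_ ?_
  · exact MeasurableSet.iInter fun i => (measurable_pi_apply i) hM
  · refine MeasurableSet.iInter fun i => MeasurableSet.iInter fun j => MeasurableSet.iInter fun _ => ?_
    exact measurableSet_lt measurable_const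
      ((measurable_pi_apply i).dist (measurable_pi_apply j))

lemma PK_comp {ι κ : Type} (e : ι ≃ κ) (S : Set (E d)) (x : ι → E d) :
    x ∘ e.symm ∈ PK d κ S ↔ x ∈ PK d ι S := by
  unfold PK
  constructor
  · rintro ⟨h1, h2⟩
    refine ⟨fun i => by simpa using h1 (e i), fun i j hij => ?_⟩
    simpa using h2 (e i) (e j) (by simpa using hij)
  · rintro ⟨h1, h2⟩
    exact ⟨fun i => h1 _, fun i j hij => h2 _ _ (by simpa using hij)⟩

lemma EX_comp {ι κ : Type} (e : ι ≃ κ) (v : E d) (x : ι → E d) :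
    x ∘ e.symm ∈ EX d κ v ↔ x ∈ EX d ι v := by
  unfold EX
  constructor
  · intro h i
    simpa using h (e i)
  · intro h i
    exact h _

lemma TR_comp {ι κ : Type} (e : ι ≃ κ) (S : Set (E d)) (v : E d) (x : ι → E d) :
    TR d S v (x ∘ e.symm) = TR d S v x := by
  ext p
  unfold TR
  refine and_congr_right fun _ => ?_
  constructor
  · intro h i
    simpa using h (e i)
  · intro h i
    exact h _

lemma vol_PK_equiv {ι κ : Type} [Fintype ι] [Fintype κ] (e : ι ≃ κ) {S : Set (E d)}
    (hM : MeasurableSet S) : volume (PK d κ S) = volume (PK d ι S) := by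
  rw [← lintegral_indicator_one (measurableSet_PK hM), ← lintegral_indicator_one (measurableSet_PK hM),
    reindex_lint e]
  congr 1
  ext x
  have h := PK_comp e S x
  by_cases hx : x ∈ PK d ι S
  · rw [Set.indicator_of_mem hx, Set.indicator_of_mem (h.2 hx)]
    rfl
  · rw [Set.indicator_of_notMem hx, Set.indicator_of_notMem (fun h' => hx (h.1 h'))]

lemma measurableSet_TRrel {S : Set (E d)} (hM : MeasurableSet S) {ι : Type} [Fintype ι] :
    MeasurableSet {q : (E d × (ι → E d)) × E d | q.2 ∈ TR d S q.1.1 q.1.2} := by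
  have h : {q : (E d × (ι → E d)) × E d | q.2 ∈ TR d S q.1.1 q.1.2} =
      {q | dist q.2 q.1.1 ≤ 2 * rd d} ∩ (Prod.snd ⁻¹' S) ∩
      ⋂ i : ι, ({q | 2 * rd d < dist (q.1.2 i) q.1.1}ᶜ ∪ {q | 2 * rd d < dist q.2 (q.1.2 i)}) := by
    ext q
    simp [TR, imp_iff_not_or]
  rw [h]
  refine MeasurableSet.inter (MeasurableSet.inter ?_ (measurable_snd hM)) ?_
  · exact measurableSet_le (by fun_prop) measurable_const
  · refine MeasurableSet.iInter fun i => ?_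
    refine MeasurableSet.union (MeasurableSet.compl ?_) ?_
    · exact measurableSet_lt measurable_const (by fun_prop)
    · exact measurableSet_lt measurable_const (by fun_prop)

lemma measurableSet_TR {S : Set (E d)} (hM : MeasurableSet S) {ι : Type} [Fintype ι] (v : E d)
    (x : ι → E d) : MeasurableSet (TR d S v x) := by
  have := measurable_prodMk_left (x := (v, x)) (measurableSet_TRrel hM (ι := ι))
  exact this

lemma measurableSet_PKTR {S : Set (E d)} (hM : MeasurableSet S) {ι κ : Type} [Fintype ι]
    [Fintype κ] :
    MeasurableSet {q : (E d × (ι → E d)) × (κ → E d) | q.2 ∈ PK d κ (TR d S q.1.1 q.1.2)} := by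
  have h : {q : (E d × (ι → E d)) × (κ → E d) | q.2 ∈ PK d κ (TR d S q.1.1 q.1.2)} =
      (⋂ i : κ, {q | q.2 i ∈ TR d S q.1.1 q.1.2}) ∩
      ⋂ i : κ, ⋂ j : κ, ⋂ _ : i ≠ j, {q | 2 * rd d < dist (q.2 i) (q.2 j)} := by
    ext q
    simp [PK]
  rw [h]
  refine MeasurableSet.inter ?_ ?_
  · refine MeasurableSet.iInter fun i => ?_
    have hf : Measurable (fun q : (E d × (ι → E d)) × (κ → E d) => (q.1, q.2 i)) := by fun_prop
    exact hf (measurableSet_TRrel hM)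
  · refine MeasurableSet.iInter fun i => MeasurableSet.iInter fun j => MeasurableSet.iInter fun _ => ?_
    exact measurableSet_lt measurable_const (by fun_prop)

lemma measurable_volPK {S : Set (E d)} (hM : MeasurableSet S) {ι κ : Type} [Fintype ι]
    [Fintype κ] : Measurable fun q : E d × (ι → E d) => volume (PK d κ (TR d S q.1 q.2)) :=
  measurable_measure_prodMk_left (measurableSet_PKTR hM)

lemma measurable_ZE {S : Set (E d)} (hM : MeasurableSet S) {ι : Type} [Fintype ι] (L : ℝ≥0∞) :
    Measurable fun q : E d × (ι → E d) => ZE d (TR d S q.1 q.2) L := by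
  unfold ZE
  exact Measurable.tsum fun k => (measurable_volPK hM).const_mul _

lemma measurable_volPK_fix {S : Set (E d)} (hM : MeasurableSet S) {ι κ : Type} [Fintype ι]
    [Fintype κ] (v : E d) : Measurable fun y : ι → E d => volume (PK d κ (TR d S v y)) := by
  have hf : Measurable fun q : (ι → E d) × (κ → E d) => ((v, q.1), q.2) := by fun_prop
  have hs : MeasurableSet {q : (ι → E d) × (κ → E d) | q.2 ∈ PK d κ (TR d S v q.1)} :=
    hf (measurableSet_PKTR hM)
  exact measurable_measure_prodMk_left hs

lemma measurable_ZE_fix {S : Set (E d)} (hM : MeasurableSet S) {ι : Type} [Fintype ι] (L : ℝ≥0∞)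
    (v : E d) : Measurable fun y : ι → E d => ZE d (TR d S v y) L := by
  unfold ZE
  exact Measurable.tsum fun k => (measurable_volPK_fix hM v).const_mul _

lemma measurableSet_EX {ι : Type} [Fintype ι] :
    MeasurableSet {q : E d × (ι → E d) | q.2 ∈ EX d ι q.1} := by
  have h : {q : E d × (ι → E d) | q.2 ∈ EX d ι q.1} =
      ⋂ i : ι, {q | 2 * rd d < dist (q.2 i) q.1} := by
    ext q
    simp [EX]
  rw [h]
  exact MeasurableSet.iInter fun i => measurableSet_lt measurable_const (by fun_prop)

lemma one_le_ZE (S : Set (E d)) (L : ℝ≥0∞) : 1 ≤ ZE d S L := by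
  unfold ZE
  refine le_trans ?_ (ENNReal.le_tsum 0)
  have : PK d (Fin 0) S = Set.univ := by
    ext x; simp [PK]
  rw [this, volume_pi]
  simp

lemma vol_PK_le {S : Set (E d)} (k : ℕ) : volume (PK d (Fin k) S) ≤ volume S ^ k := by
  calc volume (PK d (Fin k) S) ≤ volume (Set.pi Set.univ fun _ : Fin k => S) :=
        measure_mono fun x hx i _ => hx.1 i
    _ = volume S ^ k := by rw [volume_pi, Measure.pi_pi]; simp

lemma vol_PK_ne_top {S : Set (E d)} (hS : volume S ≠ ∞) (k : ℕ) :
    volume (PK d (Fin k) S) ≠ ∞ :=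
  ((vol_PK_le k).trans_lt (ENNReal.pow_lt_top hS.lt_top)).ne

lemma ZE_ne_top {S : Set (E d)} (hS : volume S ≠ ∞) {lam : ℝ} (hl : 0 < lam) :
    ZE d S (ENNReal.ofReal lam) ≠ ∞ := by
  have h : ZE d S (ENNReal.ofReal lam) ≤
      ∑' k : ℕ, ENNReal.ofReal ((lam * (volume S).toReal) ^ k / k.factorial) := by
    unfold ZE
    refine ENNReal.tsum_le_tsum fun k => ?_
    rw [ENNReal.ofReal_div_of_pos (by positivity), ENNReal.ofReal_pow (by positivity),
      ENNReal.ofReal_mul hl.le, ENNReal.ofReal_toReal hS, mul_pow, ENNReal.ofReal_natCast,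
      div_eq_mul_inv, div_eq_mul_inv, mul_right_comm]
    gcongr
    exact vol_PK_le k
  refine (h.trans_lt ?_).ne
  rw [← ENNReal.ofReal_tsum_of_nonneg (fun k => by positivity) (Real.summable_pow_div_factorial _)]
  exact ENNReal.ofReal_lt_top

lemma Zhat_eq {S : Set (E d)} (hM : MeasurableSet S) (k : ℕ) :
    Zhat d S k = (1 / (k.factorial : ℝ)) * (volume (PK d (Fin k) S)).toReal := by
  unfold Zhat
  congr 1
  exact integral_indicator_one (measurableSet_PK hM)

lemma coef_toReal {lam : ℝ} (hl : 0 < lam) (k : ℕ) :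
    (ENNReal.ofReal lam ^ k / (k.factorial : ℝ≥0∞)).toReal = lam ^ k / k.factorial := by
  simp [ENNReal.toReal_div, hl.le]

lemma coef_ne_top {lam : ℝ} (k : ℕ) :
    (ENNReal.ofReal lam ^ k / (k.factorial : ℝ≥0∞)) ≠ ∞ :=
  ENNReal.div_ne_top (by simp) (by simp [Nat.factorial_ne_zero])

lemma Zgc_eq {S : Set (E d)} (hM : MeasurableSet S) (hS : volume S ≠ ∞) {lam : ℝ}
    (hl : 0 < lam) : Zgc d S lam = (ZE d S (ENNReal.ofReal lam)).toReal := by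
  unfold Zgc ZE
  rw [ENNReal.tsum_toReal_eq]
  · refine tsum_congr fun k => ?_
    rw [Zhat_eq hM, ENNReal.toReal_mul, coef_toReal hl]
    ring
  · exact fun k => ENNReal.mul_ne_top (coef_ne_top k) (vol_PK_ne_top hS k)

open Classical in
lemma split_step {S : Set (E d)} (hM : MeasurableSet S) (L : ℝ≥0∞) (v : E d) (k : ℕ)
    (A : Finset (Fin k)) :
    ∫⁻ x : Fin k → E d, (if x ∈ PK d (Fin k) S ∧ ∀ i, i ∈ A ↔ 2 * rd d < dist (x i) v then
      (ZE d (TR d S v x) L)⁻¹ else 0) =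
    ∫⁻ y : Fin A.card → E d, (if y ∈ PK d (Fin A.card) S ∩ EX d (Fin A.card) v then
      (ZE d (TR d S v y) L)⁻¹ * volume (PK d (Fin (k - A.card)) (TR d S v y)) else 0) := by
  let p : Fin k → Prop := fun i => i ∈ A
  let F : ({i // p i} → E d) × ({i // ¬ p i} → E d) → ℝ≥0∞ := fun q =>
    (if q.1 ∈ PK d _ S ∩ EX d _ v then (ZE d (TR d S v q.1) L)⁻¹ else 0) *
      (if q.2 ∈ PK d _ (TR d S v q.1) then 1 else 0)
  have hpair : Measurable fun y : {i // p i} → E d => (v, y) := by fun_prop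
  have hEX : MeasurableSet (EX d {i // p i} v) := hpair measurableSet_EX
  have hF1 : Measurable fun y : {i // p i} → E d =>
      (if y ∈ PK d _ S ∩ EX d _ v then (ZE d (TR d S v y) L)⁻¹ else 0) :=
    Measurable.ite ((measurableSet_PK hM).inter hEX)
      ((measurable_ZE hM L).comp hpair).inv measurable_const
  have hF : Measurable F := by
    refine (hF1.comp measurable_fst).mul (Measurable.ite ?_ measurable_const measurable_const)
    have hf : Measurable fun q : ({i // p i} → E d) × ({i // ¬ p i} → E d) => ((v, q.1), q.2) := by
      fun_prop
    exact hf (measurableSet_PKTR hM)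
  have key : ∀ x : Fin k → E d,
      (if x ∈ PK d (Fin k) S ∧ ∀ i, i ∈ A ↔ 2 * rd d < dist (x i) v then
      (ZE d (TR d S v x) L)⁻¹ else 0) =
      F (MeasurableEquiv.piEquivPiSubtypeProd (fun _ => E d) p x) := by
    intro x
    let y : {i // p i} → E d := fun i => x i
    let z : {i // ¬ p i} → E d := fun i => x i
    have hF : F (MeasurableEquiv.piEquivPiSubtypeProd (fun _ => E d) p x) = F (y, z) := rfl
    rw [hF]
    have hT : (∀ i, i ∈ A ↔ 2 * rd d < dist (x i) v) → TR d S v x = TR d S v y := by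
      intro h
      ext q
      refine and_congr_right fun _ => ?_
      constructor
      · intro h' i
        exact h' i
      · intro h' i hi
        exact h' ⟨i, (h i).2 hi⟩ hi
    have hiff : (x ∈ PK d (Fin k) S ∧ ∀ i, i ∈ A ↔ 2 * rd d < dist (x i) v) ↔
        (y ∈ PK d _ S ∩ EX d _ v ∧ z ∈ PK d _ (TR d S v y)) := by
      constructor
      · rintro ⟨⟨h1, h2⟩, h3⟩
        refine ⟨⟨⟨fun i => h1 i, fun i j hij => h2 _ _ (fun h => hij (Subtype.ext h))⟩,
          fun i => (h3 i).1 i.2⟩, fun i => ⟨⟨?_, h1 i⟩, fun j hj => h2 _ _ ?_⟩,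
          fun i j hij => h2 _ _ (fun h => hij (Subtype.ext h))⟩
        · exact not_lt.1 fun h => i.2 ((h3 i).2 h)
        · intro h
          exact i.2 (h ▸ j.2)
      · rintro ⟨⟨⟨h1, h2⟩, h3⟩, h4, h5⟩
        refine ⟨⟨fun i => ?_, fun i j hij => ?_⟩, fun i => ⟨fun h => h3 ⟨i, h⟩, fun h => ?_⟩⟩
        · by_cases hi : p i
          · exact h1 ⟨i, hi⟩
          · exact (h4 ⟨i, hi⟩).1.2
        · by_cases hi : p i <;> by_cases hj : p j
          · exact h2 ⟨i, hi⟩ ⟨j, hj⟩ (fun h => hij (congrArg Subtype.val h))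
          · rw [dist_comm]
            exact (h4 ⟨j, hj⟩).2 ⟨i, hi⟩ (h3 ⟨i, hi⟩)
          · exact (h4 ⟨i, hi⟩).2 ⟨j, hj⟩ (h3 ⟨j, hj⟩)
          · exact h5 ⟨i, hi⟩ ⟨j, hj⟩ (fun h => hij (congrArg Subtype.val h))
        · by_contra hi
          exact absurd h (not_lt.2 (h4 ⟨i, hi⟩).1.1)
    by_cases hx : x ∈ PK d (Fin k) S ∧ ∀ i, i ∈ A ↔ 2 * rd d < dist (x i) v
    · have hx' := hiff.1 hx
      simp only [F]
      rw [if_pos hx, if_pos hx'.1, if_pos hx'.2, hT hx.2, mul_one]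
    · have hx' := fun h => hx (hiff.2 h)
      rw [if_neg hx]
      simp only [F]
      by_cases hy : y ∈ PK d _ S ∩ EX d _ v
      · rw [if_neg (fun hz => hx' ⟨hy, hz⟩), mul_zero]
      · rw [if_neg hy, zero_mul]
  have hcardc : Fintype.card {i // ¬ p i} = k - A.card := by
    rw [Fintype.card_subtype_compl, Fintype.card_fin]
    simp [p]
  have ec : Fin (k - A.card) ≃ {i // ¬ p i} :=
    (finCongr hcardc.symm).trans (Fintype.equivFin _).symm
  have e : Fin A.card ≃ {i // p i} := A.equivFin.symm
  simp_rw [key]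
  rw [← MeasurePreserving.lintegral_map_equiv F _
    (volume_preserving_piEquivPiSubtypeProd (fun _ : Fin k => E d) p)]
  rw [Measure.volume_eq_prod, lintegral_prod _ hF.aemeasurable]
  refine (@reindex_lint d _ _ _ (Subtype.fintype p) e _).trans ?_
  refine lintegral_congr fun y => ?_
  simp only [F]
  have hTm := measurableSet_TR hM v (y ∘ e.symm)
  have h1 : ∫⁻ z : {i // ¬ p i} → E d, (if z ∈ PK d _ (TR d S v (y ∘ e.symm)) then (1 : ℝ≥0∞) else 0) =
      volume (PK d {i // ¬ p i} (TR d S v (y ∘ e.symm))) := by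
    rw [← lintegral_indicator_one (measurableSet_PK hTm)]
    rfl
  rw [lintegral_const_mul, h1, vol_PK_equiv ec hTm, TR_comp]
  · simp only [Set.mem_inter_iff, PK_comp, EX_comp, ite_mul, zero_mul]
  · exact Measurable.ite (measurableSet_PK hTm) measurable_const measurable_const

open Classical in
lemma split_sum {S : Set (E d)} (hM : MeasurableSet S) (L : ℝ≥0∞) (v : E d) (k : ℕ) :
    ∫⁻ x : Fin k → E d, (if x ∈ PK d (Fin k) S then (ZE d (TR d S v x) L)⁻¹ else 0) =
    ∑ m ∈ Finset.range (k + 1), k.choose m •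
    ∫⁻ y : Fin m → E d, (if y ∈ PK d (Fin m) S ∩ EX d (Fin m) v then
      (ZE d (TR d S v y) L)⁻¹ * volume (PK d (Fin (k - m)) (TR d S v y)) else 0) := by
  have h := Finset.sum_powerset_apply_card (fun m => 
    ∫⁻ y : Fin m → E d, (if y ∈ PK d (Fin m) S ∩ EX d (Fin m) v then
      (ZE d (TR d S v y) L)⁻¹ * volume (PK d (Fin (k - m)) (TR d S v y)) else 0))
      (x := (Finset.univ : Finset (Fin k)))
  rw [Finset.card_univ, Fintype.card_fin] at h
  rw [← h]
  simp_rw [← split_step hM L v k]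
  rw [← lintegral_finsetSum]
  · refine lintegral_congr fun x => ?_
    rw [Finset.sum_eq_single (Finset.univ.filter fun i => 2 * rd d < dist (x i) v)]
    · simp
    · intro B _ hB
      rw [if_neg]
      rintro ⟨-, h2⟩
      exact hB (by ext i; simp [h2])
    · simp
  · intro A _
    have hpair : Measurable fun y : Fin k → E d => (v, y) := by fun_prop
    have h : {x : Fin k → E d | x ∈ PK d (Fin k) S ∧ ∀ i, i ∈ A ↔ 2 * rd d < dist (x i) v} =
        PK d (Fin k) S ∩ ⋂ i : Fin k, {x : Fin k → E d | i ∈ A ↔ 2 * rd d < dist (x i) v} := by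
      ext x
      simp
    have hms : MeasurableSet
        {x : Fin k → E d | x ∈ PK d (Fin k) S ∧ ∀ i, i ∈ A ↔ 2 * rd d < dist (x i) v} := by
      rw [h]
      refine (measurableSet_PK hM).inter (MeasurableSet.iInter fun i => ?_)
      have hlt : MeasurableSet {x : Fin k → E d | 2 * rd d < dist (x i) v} :=
        measurableSet_lt measurable_const (by fun_prop)
      by_cases hi : i ∈ A
      · simpa only [hi, true_iff] using hlt
      · simp only [hi, false_iff]
        exact hlt.compl
    exact Measurable.ite hms ((measurable_ZE hM L).comp hpair).inv measurable_const

lemma tsum_antidiag (f : ℕ → ℕ → ℝ≥0∞) :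
    ∑' k : ℕ, ∑ p ∈ Finset.HasAntidiagonal.antidiagonal k, f p.1 p.2 = ∑' m, ∑' j, f m j := by
  rw [← ENNReal.tsum_prod, ← Finset.HasAntidiagonal.sigmaAntidiagonalEquivProd.tsum_eq,
    ENNReal.tsum_sigma']
  refine tsum_congr fun k => ?_
  rw [← Finset.tsum_subtype]
  rfl

lemma coef_mul (L : ℝ≥0∞) (m j : ℕ) (x : ℝ≥0∞) :
    L ^ (m + j) / ((m + j).factorial : ℝ≥0∞) * ((m + j).choose m • x) =
      (L ^ m / (m.factorial : ℝ≥0∞)) * ((L ^ j / (j.factorial : ℝ≥0∞)) * x) := by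
  have h : ((m + j).factorial : ℝ≥0∞) = (m + j).choose m * (m.factorial * j.factorial) := by
    rw [← Nat.add_choose_mul_factorial_mul_factorial m j, Nat.choose_symm_add]
    push_cast
    ring
  have hm : (m.factorial : ℝ≥0∞) ≠ 0 := by simp [Nat.factorial_ne_zero]
  have hj : (j.factorial : ℝ≥0∞) ≠ 0 := by simp [Nat.factorial_ne_zero]
  have hc0 : ((m + j).choose m : ℝ≥0∞) ≠ 0 := by
    simpa using (Nat.choose_pos (Nat.le_add_right m j)).ne'
  have hct : ((m + j).choose m : ℝ≥0∞) ≠ ∞ := ENNReal.natCast_ne_top _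
  rw [nsmul_eq_mul, h, div_eq_mul_inv, div_eq_mul_inv, div_eq_mul_inv,
    ENNReal.mul_inv (Or.inl hc0) (Or.inl hct), ENNReal.mul_inv (Or.inl hm) (Or.inl (by simp)), pow_add]
  calc _ = L ^ m * L ^ j * (((m + j).choose m : ℝ≥0∞)⁻¹ * ((m + j).choose m : ℝ≥0∞)) *
      ((m.factorial : ℝ≥0∞)⁻¹ * (j.factorial : ℝ≥0∞)⁻¹) * x := by ring
    _ = _ := by rw [ENNReal.inv_mul_cancel hc0 hct]; ring

open Classical in
lemma inner_one {S : Set (E d)} (hM : MeasurableSet S) (hS : volume S ≠ ∞) {lam : ℝ}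
    (hl : 0 < lam) (v : E d) (m : ℕ) :
    ∑' j : ℕ, ENNReal.ofReal lam ^ j / (j.factorial : ℝ≥0∞) *
      ∫⁻ y : Fin m → E d, (if y ∈ PK d (Fin m) S ∩ EX d (Fin m) v then
        (ZE d (TR d S v y) (ENNReal.ofReal lam))⁻¹ * volume (PK d (Fin j) (TR d S v y)) else 0) =
      volume (PK d (Fin m) S ∩ EX d (Fin m) v) := by
  have hZt : ∀ T : Set (E d), volume T ≠ ∞ → ZE d T (ENNReal.ofReal lam) ≠ ∞ :=
    fun T hT => ZE_ne_top hT hl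
  generalize ENNReal.ofReal lam = L at *
  have hpair : Measurable fun y : Fin m → E d => (v, y) := by fun_prop
  have hEX : MeasurableSet (EX d (Fin m) v) := hpair measurableSet_EX
  have hPE := (measurableSet_PK (ι := Fin m) hM).inter hEX
  have hZm : Measurable fun y : Fin m → E d => ZE d (TR d S v y) L :=
    measurable_ZE_fix hM L v
  have hVm : ∀ j, Measurable fun y : Fin m → E d => volume (PK d (Fin j) (TR d S v y)) := fun j =>
    measurable_volPK_fix hM v
  have hGm : ∀ j, Measurable fun y : Fin m → E d => (if y ∈ PK d (Fin m) S ∩ EX d (Fin m) v then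
      (ZE d (TR d S v y) L)⁻¹ * volume (PK d (Fin j) (TR d S v y)) else 0) := fun j =>
    Measurable.ite hPE (hZm.inv.mul (hVm j)) measurable_const
  rw [tsum_congr fun j => (lintegral_const_mul (L ^ j / (j.factorial : ℝ≥0∞)) (hGm j)).symm]
  rw [← lintegral_tsum (fun j => ((hGm j).const_mul _).aemeasurable),
    ← lintegral_indicator_one hPE]
  refine lintegral_congr fun y => ?_
  by_cases hy : y ∈ PK d (Fin m) S ∩ EX d (Fin m) v
  · simp only [if_pos hy, Set.indicator_of_mem hy]
    have hT : volume (TR d S v y) ≠ ∞ := measure_ne_top_of_subset (fun q hq => hq.1.2) hS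
    have : ∑' j : ℕ, L ^ j / (j.factorial : ℝ≥0∞) * ((ZE d (TR d S v y) L)⁻¹ *
        volume (PK d (Fin j) (TR d S v y))) = (ZE d (TR d S v y) L)⁻¹ * ZE d (TR d S v y) L := by
      generalize (ZE d (TR d S v y) L)⁻¹ = c
      unfold ZE
      rw [← ENNReal.tsum_mul_left]
      exact tsum_congr fun j => by ring
    rw [this, ENNReal.inv_mul_cancel (zero_lt_one.trans_le (one_le_ZE _ _)).ne' (hZt _ hT)]
    rfl
  · simp only [if_neg hy, Set.indicator_of_notMem hy]
    simp

open Classical in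
lemma main_v {S : Set (E d)} (hM : MeasurableSet S) (hS : volume S ≠ ∞) {lam : ℝ}
    (hl : 0 < lam) (v : E d) :
    ∑' k : ℕ, ENNReal.ofReal lam ^ k / (k.factorial : ℝ≥0∞) *
      ∫⁻ x : Fin k → E d, (if x ∈ PK d (Fin k) S then
        (ZE d (TR d S v x) (ENNReal.ofReal lam))⁻¹ else 0) =
    ∑' m : ℕ, ENNReal.ofReal lam ^ m / (m.factorial : ℝ≥0∞) *
      volume (PK d (Fin m) S ∩ EX d (Fin m) v) := by
  set L := ENNReal.ofReal lam with hL
  let G : ℕ → ℕ → ℝ≥0∞ := fun m j =>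
    ∫⁻ y : Fin m → E d, (if y ∈ PK d (Fin m) S ∩ EX d (Fin m) v then
      (ZE d (TR d S v y) L)⁻¹ * volume (PK d (Fin j) (TR d S v y)) else 0)
  have h1 : ∀ k : ℕ, L ^ k / (k.factorial : ℝ≥0∞) *
      ∫⁻ x : Fin k → E d, (if x ∈ PK d (Fin k) S then (ZE d (TR d S v x) L)⁻¹ else 0) =
      ∑ p ∈ Finset.HasAntidiagonal.antidiagonal k, (L ^ p.1 / (p.1.factorial : ℝ≥0∞)) *
        ((L ^ p.2 / (p.2.factorial : ℝ≥0∞)) * G p.1 p.2) := by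
    intro k
    rw [split_sum hM, Finset.mul_sum, Finset.Nat.sum_antidiagonal_eq_sum_range_succ
      (fun a b => (L ^ a / (a.factorial : ℝ≥0∞)) * ((L ^ b / (b.factorial : ℝ≥0∞)) * G a b))]
    refine Finset.sum_congr rfl fun m hm => ?_
    obtain ⟨j, rfl⟩ := Nat.exists_eq_add_of_le (Nat.lt_succ_iff.1 (Finset.mem_range.1 hm))
    rw [Nat.add_sub_cancel_left, coef_mul]
  rw [tsum_congr h1]
  rw [tsum_antidiag (fun a b => (L ^ a / (a.factorial : ℝ≥0∞)) *
    ((L ^ b / (b.factorial : ℝ≥0∞)) * G a b))]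
  refine tsum_congr fun m => ?_
  rw [ENNReal.tsum_mul_left]
  congr 1
  exact inner_one hM hS hl v m

lemma vol_succ {S : Set (E d)} (hM : MeasurableSet S) (k : ℕ) :
    volume (PK d (Fin (k + 1)) S) =
      ∫⁻ v in S, volume (PK d (Fin k) S ∩ EX d (Fin k) v) := by
  have hm : MeasurableSet {q : E d × (Fin k → E d) | q.1 ∈ S ∧ q.2 ∈ PK d (Fin k) S ∩ EX d (Fin k) q.1} :=
    (measurable_fst hM).inter ((measurable_snd (measurableSet_PK hM)).inter measurableSet_EX)
  have h := (volume_preserving_piFinSuccAbove (fun _ : Fin (k + 1) => E d) 0).measure_preimage_equiv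
    {q : E d × (Fin k → E d) | q.1 ∈ S ∧ q.2 ∈ PK d (Fin k) S ∩ EX d (Fin k) q.1}
  have h2 : (MeasurableEquiv.piFinSuccAbove (fun _ : Fin (k + 1) => E d) 0) ⁻¹'
      {q : E d × (Fin k → E d) | q.1 ∈ S ∧ q.2 ∈ PK d (Fin k) S ∩ EX d (Fin k) q.1} =
      PK d (Fin (k + 1)) S := by
    ext x
    change (x 0 ∈ S ∧ ((∀ i : Fin k, x i.succ ∈ S) ∧ ∀ i j : Fin k, i ≠ j →
      dist (x i.succ) (x j.succ) > 2 * rd d) ∧ ∀ i : Fin k, 2 * rd d < dist (x i.succ) (x 0)) ↔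
      ((∀ i, x i ∈ S) ∧ ∀ i j, i ≠ j → dist (x i) (x j) > 2 * rd d)
    constructor
    · rintro ⟨h0, ⟨h1, h2⟩, h3⟩
      refine ⟨Fin.cases h0 h1, fun i j => ?_⟩
      refine Fin.cases ?_ (fun i => ?_) i <;> refine Fin.cases ?_ (fun j => ?_) j
      · intro h; exact absurd rfl h
      · intro _; rw [dist_comm]; exact h3 j
      · intro _; exact h3 i
      · intro h; exact h2 i j (fun h' => h (by rw [h']))
    · rintro ⟨h1, h2⟩
      exact ⟨h1 0, ⟨fun i => h1 _, fun i j hij => h2 _ _ (by simpa using hij)⟩,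
        fun i => h2 _ _ (Fin.succ_ne_zero i)⟩
  rw [← h2, h, Measure.volume_eq_prod, Measure.prod_apply hm, ← lintegral_indicator hM]
  refine lintegral_congr fun v => ?_
  by_cases hv : v ∈ S
  · rw [Set.indicator_of_mem hv]
    congr 1
    ext x
    simp [hv]
  · rw [Set.indicator_of_notMem hv]
    simp [hv]

end HS

open HS ENNReal in
/-- `α_S(λ) = λ E[1 / Z_{T(v,X)}(λ)]` where the expectation is over the
two-part experiment. -/
theorem alphaS_eq_lam_mul_exp_inv_ZT (d : ℕ) (S : Set (EuclideanSpace ℝ (Fin d)))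
    (hB : Bornology.IsBounded S) (hM : MeasurableSet S) (hv : 0 < volume S)
    (lam : ℝ) (hlam : 0 < lam) :
    alphaS d S lam =
      lam * ExpT d S lam (fun v _k x => 1 / Zgc d (Treg d S v x) lam) := by
  classical
  have hS : volume S ≠ ∞ := hB.measure_lt_top.ne
  set L := ENNReal.ofReal lam with hL
  -- the inner integral
  let I : ℕ → E d → ℝ≥0∞ := fun k v => ∫⁻ x : Fin k → E d, (if x ∈ PK d (Fin k) S then
        (ZE d (TR d S v x) L)⁻¹ else 0)
  have hIm0 : ∀ k, Measurable fun q : E d × (Fin k → E d) => (if q.2 ∈ PK d (Fin k) S then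
        (ZE d (TR d S q.1 q.2) L)⁻¹ else 0) := fun k =>
    Measurable.ite (measurable_snd (measurableSet_PK hM)) (measurable_ZE hM L).inv measurable_const
  have hIm : ∀ k, Measurable (I k) := fun k => (hIm0 k).lintegral_prod_right'
  have hIle : ∀ k v, I k v ≤ volume (PK d (Fin k) S) := by
    intro k v
    rw [← lintegral_indicator_one (measurableSet_PK hM)]
    refine lintegral_mono fun x => ?_
    by_cases hx : x ∈ PK d (Fin k) S
    · simp only [if_pos hx, Set.indicator_of_mem hx]
      exact ENNReal.inv_le_one.2 (one_le_ZE _ _)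
    · simp [if_neg hx]
  have hIt : ∀ k v, I k v < ∞ := fun k v => (hIle k v).trans_lt (vol_PK_ne_top hS k).lt_top
  have hinner : ∀ k v, ∫ x : Fin k → E d, Set.indicator (packSet d k S)
      (fun y => 1 / Zgc d (Treg d S v y) lam) x = (I k v).toReal := by
    intro k v
    have hpair : Measurable fun y : Fin k → E d => (v, y) := by fun_prop
    have hIe : (I k v).toReal = ∫ x : Fin k → E d, ENNReal.toReal
        (if x ∈ PK d (Fin k) S then (ZE d (TR d S v x) L)⁻¹ else 0) := by
      refine (integral_toReal ((hIm0 k).comp hpair).aemeasurable ?_).symm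
      refine Eventually.of_forall fun x => ?_
      refine lt_of_le_of_lt ?_ ENNReal.one_lt_top
      change (if x ∈ PK d (Fin k) S then (ZE d (TR d S v x) L)⁻¹ else 0) ≤ 1
      split_ifs
      · exact ENNReal.inv_le_one.2 (one_le_ZE _ _)
      · exact zero_le_one
    rw [hIe]
    · refine integral_congr_ae (Eventually.of_forall fun x => ?_)
      change Set.indicator (PK d (Fin k) S) (fun y => 1 / Zgc d (TR d S v y) lam) x = 
        ENNReal.toReal (if x ∈ PK d (Fin k) S then (ZE d (TR d S v x) L)⁻¹ else 0)
      by_cases hx : x ∈ PK d (Fin k) S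
      · rw [Set.indicator_of_mem hx, if_pos hx, ENNReal.toReal_inv, Zgc_eq (measurableSet_TR hM v x)
          (measure_ne_top_of_subset (fun q hq => hq.1.2) hS) hlam, one_div]
      · rw [Set.indicator_of_notMem hx, if_neg hx, ENNReal.toReal_zero]
  have hJt : ∀ k, ∫⁻ v in S, I k v ≠ ∞ := by
    intro k
    refine ((lintegral_mono fun v => hIle k v).trans_lt ?_).ne
    rw [lintegral_const, Measure.restrict_apply_univ]
    exact ENNReal.mul_lt_top (vol_PK_ne_top hS k).lt_top hS.lt_top
  have hR : ∑' k : ℕ, (lam ^ k / (Nat.factorial k : ℝ)) *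
      ∫ v in S, ∫ x : Fin k → E d, Set.indicator (packSet d k S)
        (fun y => 1 / Zgc d (Treg d S v y) lam) x =
      (∑' k : ℕ, L ^ k / (k.factorial : ℝ≥0∞) * ∫⁻ v in S, I k v).toReal := by
    rw [ENNReal.tsum_toReal_eq fun k => ENNReal.mul_ne_top (coef_ne_top k) (hJt k)]
    refine tsum_congr fun k => ?_
    rw [ENNReal.toReal_mul, coef_toReal hlam]
    congr 1
    simp_rw [hinner]
    exact integral_toReal (hIm k).aemeasurable (Eventually.of_forall fun v => hIt k v)
  have hVm : ∀ k, Measurable fun v : E d => volume (PK d (Fin k) S ∩ EX d (Fin k) v) := by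
    intro k
    exact measurable_measure_prodMk_left (ν := (volume : Measure (Fin k → E d)))
      (s := {q : E d × (Fin k → E d) | q.2 ∈ PK d (Fin k) S ∩ EX d (Fin k) q.1})
      ((measurable_snd (measurableSet_PK hM)).inter measurableSet_EX)
  have hE : ∑' k : ℕ, L ^ k / (k.factorial : ℝ≥0∞) * ∫⁻ v in S, I k v =
      ∑' k : ℕ, L ^ k / (k.factorial : ℝ≥0∞) * volume (PK d (Fin (k + 1)) S) := by
    simp_rw [vol_succ hM]
    simp_rw [← fun k : ℕ => lintegral_const_mul (μ := volume.restrict S)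
      (L ^ k / (k.factorial : ℝ≥0∞)) (hIm k), ← fun k : ℕ => lintegral_const_mul
      (μ := volume.restrict S) (L ^ k / (k.factorial : ℝ≥0∞)) (hVm k)]
    rw [← lintegral_tsum fun k => ((hIm k).const_mul _).aemeasurable,
      ← lintegral_tsum fun k => ((hVm k).const_mul _).aemeasurable]
    exact lintegral_congr fun v => main_v hM hS hlam v
  have hLft : ∑' k : ℕ, (k : ℝ) * lam ^ k * Zhat d S k =
      lam * (∑' k : ℕ, L ^ k / (k.factorial : ℝ≥0∞) * volume (PK d (Fin (k + 1)) S)).toReal := by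
    rw [ENNReal.tsum_toReal_eq fun k => ENNReal.mul_ne_top (coef_ne_top k) (vol_PK_ne_top hS _),
      ← tsum_mul_left]
    have h0 : Function.support (fun k : ℕ => (k : ℝ) * lam ^ k * Zhat d S k) ⊆
        Set.range Nat.succ := by
      intro k hk
      cases k with
      | zero => simp at hk
      | succ n => exact ⟨n, rfl⟩
    rw [← Function.Injective.tsum_eq Nat.succ_injective h0]
    refine tsum_congr fun k => ?_
    rw [Zhat_eq hM, ENNReal.toReal_mul, coef_toReal hlam, Nat.succ_eq_add_one, Nat.factorial_succ]
    have : (k.factorial : ℝ) ≠ 0 := by positivity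
    have : ((k : ℝ) + 1) ≠ 0 := by positivity
    push_cast
    field_simp
    ring
  unfold alphaS ExpT
  rw [hLft, hR, hE]
  ring
end
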